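/- arXiv:1802.08078 — 3 statements merged into one kernel-verified Lean document; each statement's English description precedes it below -/
import Mathlib

section
/- Let T be a complete first-order theory in a countable language with infinite models. Suppose there exist n and a complete n-type p over the empty set consistent with T that is powerful, i.e., every countable model of T realizing p realizes every complete type (of any finite arity) over the empty set consistent with T. Then T is small: for every m, the set of complete m-types over the empty set consistent with T is countable. -/
open FirstOrder FirstOrder.Language Cardinal

universe u v w w'

namespace QOM

variable {L : FirstOrder.Language.{u, v}}

/-- `v` realizes the complete type `p` (over `∅`, in variables `α`). -/
def RealizesType {T : L.Theory} {α : Type w} (p : T.CompleteType α)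
    {M : Type*} [L.Structure M] (v : α → M) : Prop :=
  ∀ φ : L.Formula α, Formula.equivSentence φ ∈ p → φ.Realize v

/-- A theory is small if for each `m` there are only countably many complete `m`-types. -/
def IsSmall (T : L.Theory) : Prop :=
  ∀ m : ℕ, Countable (T.CompleteType (Fin m))

theorem exists_countable_real [Countable L.Symbols] {T : L.Theory} {n : ℕ}
    (p : T.CompleteType (Fin n)) :
    ∃ M : Theory.ModelType.{u, v, 0} T, Countable M.Carrier ∧
      ∃ va : Fin n → M.Carrier, RealizesType p va := by
  obtain ⟨N, va, hva⟩ := Theory.exists_modelType_is_realized_in T p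
  have key : ∃ S : L.ElementarySubstructure N, Set.range va ⊆ S ∧ Countable S := by
    by_cases hN : Countable N
    · exact ⟨⊤, fun x _ => trivial, inferInstance⟩
    · have hN' : ℵ₀ ≤ #N := by
        by_contra h
        exact hN (Cardinal.mk_le_aleph0_iff.1 (not_le.1 h).le)
      obtain ⟨S, hS, hc⟩ := exists_elementarySubstructure_card_eq L (Set.range va) aleph0.{0} le_rfl
        (by simpa using (Set.countable_range va).le_aleph0)
        (by
          have : L.card ≤ ℵ₀ := Cardinal.mk_le_aleph0_iff.2 inferInstance
          simpa using this)
        (by simpa using hN')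
      refine ⟨S, hS, ?_⟩
      rw [← Cardinal.mk_le_aleph0_iff]
      simpa using hc.le
  obtain ⟨S, hS, hc⟩ := key
  let wa : Fin n → S := fun i => ⟨va i, hS ⟨i, rfl⟩⟩
  have hsm : Small.{0} S := Countable.toSmall _
  let M := Theory.ModelType.of T S
  let e : M ≃ Shrink.{0} S := equivShrink S
  refine ⟨Theory.ModelType.equivInduced e, ?_, e ∘ wa, ?_⟩
  · exact (equivShrink.{0} S).symm.injective.countable
  · intro φ hφ
    rw [← hva, Theory.CompleteType.formula_mem_typeOf] at hφ
    have h1 : φ.Realize wa := (S.subtype.map_formula φ wa).1 hφ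
    letI : L.Structure (Shrink.{0} S) := e.inducedStructure
    exact (StrongHomClass.realize_formula (L := L) (M := M)
      (e.inducedStructureEquiv (L := L)) φ).2 h1

theorem RealizesType.eq_typeOf {T : L.Theory} {α : Type w} (q : T.CompleteType α)
    (M : Theory.ModelType.{u, v, w'} T) (x : α → M) (h : RealizesType q x) :
    q = T.typeOf x := by
  have hle : ∀ φ, φ ∈ q → φ ∈ T.typeOf x := fun φ hφ => by
    rw [Theory.CompleteType.mem_typeOf]
    exact h _ (by simpa using hφ)
  refine SetLike.ext fun φ => ⟨hle φ, fun hφ => ?_⟩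
  refine (q.mem_or_not_mem φ).resolve_right fun hn => ?_
  exact ((T.typeOf x).not_mem_iff φ).1 (hle _ hn) hφ

/-- If a complete theory `T` in a countable language with infinite models has a powerful
type, then `T` is small. -/
theorem powerful_type_implies_small [Countable L.Symbols]
    (T : L.Theory) (hT : T.IsComplete)
    (hinf : ∃ M : Theory.ModelType.{u, v, 0} T, Infinite M.Carrier)
    (hpow : ∃ (n : ℕ) (p : T.CompleteType (Fin n)),
      ∀ M : Theory.ModelType.{u, v, 0} T, Countable M.Carrier →
        (∃ va : Fin n → M.Carrier, RealizesType p va) →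
        ∀ (m : ℕ) (q : T.CompleteType (Fin m)),
          ∃ wa : Fin m → M.Carrier, RealizesType q wa) :
    IsSmall T := by
  obtain ⟨n, p, hp⟩ := hpow
  obtain ⟨M, hM, hr⟩ := exists_countable_real p
  intro m
  choose f hf using hp M hM hr m
  refine Function.Injective.countable (f := f) fun q r h => ?_
  rw [RealizesType.eq_typeOf q M _ (hf q), RealizesType.eq_typeOf r M _ (hf r), h]

end QOM
end

section
/- For all natural numbers k and s there exists an o-minimal complete theory T in a countable language having exactly 3^k · 6^s pairwise non-isomorphic countable models. -/
open FirstOrder FirstOrder.Language Cardinal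

universe u v w w'

namespace QOM

variable {L : FirstOrder.Language.{u, v}}

/-- Bundled countable models of `T` (carrier in `Type 0`). -/
def CtbleModel (T : L.Theory) : Type _ :=
  { M : Theory.ModelType.{u, v, 0} T // Countable M.Carrier }

/-- Isomorphism is an equivalence relation on countable models. -/
def isoSetoid (T : L.Theory) : Setoid (CtbleModel T) where
  r M N := Nonempty (M.1.Carrier ≃[L] N.1.Carrier)
  iseqv := ⟨fun M => ⟨Language.Equiv.refl L M.1.Carrier⟩,
    fun ⟨e⟩ => ⟨e.symm⟩, fun ⟨e⟩ ⟨f⟩ => ⟨f.comp e⟩⟩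

/-- `I(T,ω)`: the number of pairwise non-isomorphic countable models of `T`. -/
noncomputable def IOmega (T : L.Theory) : Cardinal :=
  #(Quotient (isoSetoid T))

/-- The binary relation interpreting the symbol `lt` in `M`. -/
def ltInterp (lt : L.Relations 2) {M : Type*} [L.Structure M] : M → M → Prop :=
  fun a b => Structure.RelMap lt ![a, b]

/-- `r` is a strict linear order. -/
def IsStrictLinearOrderRel {M : Type*} (r : M → M → Prop) : Prop :=
  (∀ a, ¬ r a a) ∧ (∀ a b c, r a b → r b c → r a c) ∧ (∀ a b, r a b ∨ a = b ∨ r b a)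

/-- A subset of `M` definable with parameters. -/
def DefinableWithParams (L : FirstOrder.Language.{u, v}) (M : Type w) [L.Structure M]
    (s : Set M) : Prop :=
  ∃ (k : ℕ) (φ : L.Formula (Fin k ⊕ Fin 1)) (c : Fin k → M),
    s = {x | φ.Realize (Sum.elim c (fun _ => x))}

/-- The open interval of `r` with endpoints in `M ∪ {-∞}` and `M ∪ {+∞}`
(`none` codes `-∞`/`+∞`). -/
def OIntv {M : Type*} (r : M → M → Prop) (a b : Option M) : Set M :=
  {x | (∀ y ∈ a, r y x) ∧ (∀ y ∈ b, r x y)}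

/-- `M` is an o-minimal structure (with respect to the order symbol `lt`): every definable
subset of `M` is a finite union of singletons and open intervals. -/
def OMinimalStructure (lt : L.Relations 2) (M : Type w) [L.Structure M] : Prop :=
  IsStrictLinearOrderRel (ltInterp lt (M := M)) ∧
  ∀ s : Set M, DefinableWithParams L M s →
    ∃ (N : ℕ) (f : Fin N → Set M), s = ⋃ i, f i ∧
      ∀ i, (∃ x, f i = {x}) ∨ ∃ a b : Option M, f i = OIntv (ltInterp lt) a b

/-- `T` is an o-minimal theory: every model of `T` is o-minimal. -/
def OMinimalTheory (lt : L.Relations 2) (T : L.Theory) : Prop :=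
  ∀ (M : Type w) [L.Structure M], M ⊨ T → OMinimalStructure lt M

section Lang

/-- Function symbols: constants indexed by `I`. -/
inductive Fn (I : Type) : ℕ → Type
  | c (i : I) : Fn I 0

/-- Relation symbols: a single binary symbol. -/
inductive Rl : ℕ → Type
  | lt : Rl 2

/-- The language of orders with constants indexed by `I`. -/
def Lg (I : Type) : FirstOrder.Language.{0, 0} := ⟨Fn I, Rl⟩

variable {I : Type}

/-- the order symbol -/
def ltS (I : Type) : (Lg I).Relations 2 := Rl.lt

/-- the constant symbols -/
def cS (i : I) : (Lg I).Functions 0 := Fn.c i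

theorem Lg_countable [Countable I] : Countable (Lg I).Symbols := by
  have h1 : Countable (Σ l, (Lg I).Functions l) := by
    let f : I → (Σ l, (Lg I).Functions l) := fun i => ⟨0, Fn.c i⟩
    refine Function.Surjective.countable (f := f) ?_
    rintro ⟨l, h⟩
    cases h with
    | c i => exact ⟨i, rfl⟩
  have h2 : Countable (Σ l, (Lg I).Relations l) := by
    let f : Unit → (Σ l, (Lg I).Relations l) := fun i => ⟨2, Rl.lt⟩
    refine Function.Surjective.countable (f := f) ?_
    rintro ⟨l, h⟩
    cases h with
    | lt => exact ⟨(), rfl⟩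
  unfold Language.Symbols
  infer_instance

/-- The structure given by an order and constants. -/
@[reducible] def mkStr {M : Type*} [LT M] (c : I → M) : (Lg I).Structure M where
  funMap := fun f _ => match f with
    | Fn.c i => c i
  RelMap := fun r x => match r, x with
    | Rl.lt, x => x 0 < x 1

/-- interpretation of constants -/
def cst (M : Type*) [(Lg I).Structure M] (i : I) : M := Structure.funMap (cS i) ![]

/-- Being a model, relative to a linear order. -/
structure IsMod (g : I → ℚ) (M : Type*) [(Lg I).Structure M] [LinearOrder M] : Prop where
  lt_iff : ∀ a b : M, Structure.RelMap (ltS I) ![a, b] ↔ a < b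
  dense : DenselyOrdered M
  nomin : NoMinOrder M
  nomax : NoMaxOrder M
  ne : Nonempty M
  cst_lt : ∀ i j, g i < g j → cst M i < cst M j
  cst_eq : ∀ i j, g i = g j → cst M i = cst M j

theorem IsMod.cst_lt_iff {g : I → ℚ} {M : Type*} [(Lg I).Structure M] [LinearOrder M]
    (h : IsMod g M) (i j : I) : cst M i < cst M j ↔ g i < g j := by
  refine ⟨fun hh => ?_, h.cst_lt i j⟩
  rcases lt_trichotomy (g i) (g j) with h1 | h1 | h1
  · exact h1
  · exact absurd (h.cst_eq _ _ h1) hh.ne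
  · exact absurd (h.cst_lt _ _ h1) hh.asymm

theorem IsMod.cst_cmp {g : I → ℚ} {M : Type*} [(Lg I).Structure M] [LinearOrder M]
    (h : IsMod g M) (i j : I) : cmp (cst M i) (cst M j) = cmp (g i) (g j) := by
  rcases lt_trichotomy (g i) (g j) with h1 | h1 | h1
  · rw [(cmp_eq_lt_iff _ _).2 h1, (cmp_eq_lt_iff _ _).2 (h.cst_lt _ _ h1)]
  · rw [(cmp_eq_eq_iff _ _).2 h1, (cmp_eq_eq_iff _ _).2 (h.cst_eq _ _ h1)]
  · rw [(cmp_eq_gt_iff _ _).2 h1, (cmp_eq_gt_iff _ _).2 (h.cst_lt _ _ h1)]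

theorem isMod_mkStr (g : I → ℚ) {M : Type*} [LinearOrder M] [DenselyOrdered M] [NoMinOrder M]
    [NoMaxOrder M] [Nonempty M] (c : I → M) (h1 : ∀ i j, g i < g j → c i < c j)
    (h2 : ∀ i j, g i = g j → c i = c j) : @IsMod I g M (mkStr c) _ := by
  let := mkStr c
  exact ⟨fun a b => Iff.rfl, inferInstance, inferInstance, inferInstance, inferInstance, h1, h2⟩

/-- The theory. -/
def Th (g : I → ℚ) : (Lg I).Theory := @Language.completeTheory (Lg I) ℚ (mkStr g)

theorem Th_complete (g : I → ℚ) : (Th g).IsComplete := by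
  let := mkStr g
  exact completeTheory.isComplete (Lg I) ℚ

theorem realize_term {α : Type*} (t : (Lg I).Term α) :
    ∃ F : Finset I, ∀ (M : Type u) (N : Type w) [(Lg I).Structure M] [(Lg I).Structure N]
      (P : Set (M × N)), (∀ i ∈ F, (cst M i, cst N i) ∈ P) → ∀ (v : α → M) (v' : α → N),
      (∀ a, (v a, v' a) ∈ P) → (t.realize v, t.realize v') ∈ P := by
  cases t with
  | var a => exact ⟨∅, fun M N _ _ P _ v v' h => h a⟩
  | func f ts =>
    cases f with
    | c i =>
      refine ⟨{i}, fun M N _ _ P hP v v' h => ?_⟩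
      have := hP i (by simp)
      simp only [Term.realize]
      convert this using 2
      · unfold cst cS; congr 1; exact Subsingleton.elim _ _
      · unfold cst cS; congr 1; exact Subsingleton.elim _ _

theorem ef (g : I → ℚ) {α : Type*} {n : ℕ} (φ : (Lg I).BoundedFormula α n) :
    ∃ F : Finset I, ∀ (M : Type u) (N : Type w) [(Lg I).Structure M] [(Lg I).Structure N]
      [LinearOrder M] [LinearOrder N], IsMod g M → IsMod g N → ∀ (P : Order.PartialIso M N),
      (∀ i ∈ F, (cst M i, cst N i) ∈ P.val) → ∀ (v : α → M) (v' : α → N)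
      (xs : Fin n → M) (xs' : Fin n → N),
      (∀ a, (v a, v' a) ∈ P.val) → (∀ a, (xs a, xs' a) ∈ P.val) →
      (φ.Realize v xs ↔ φ.Realize v' xs') := by
  classical
  induction φ with
  | falsum => exact ⟨∅, by intros; rfl⟩
  | equal t₁ t₂ =>
    obtain ⟨F1, h1⟩ := realize_term.{u, w} t₁
    obtain ⟨F2, h2⟩ := realize_term.{u, w} t₂
    refine ⟨F1 ∪ F2, fun M N _ _ _ _ hM hN P hP v v' xs xs' hv hxs => ?_⟩
    have e : ∀ a, (Sum.elim v xs a, Sum.elim v' xs' a) ∈ P.val := by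
      rintro (a | a)
      · exact hv a
      · exact hxs a
    have e1 := h1 M N P.val (fun i hi => hP i (by simp [hi])) _ _ e
    have e2 := h2 M N P.val (fun i hi => hP i (by simp [hi])) _ _ e
    have := P.prop _ e1 _ e2
    simp only [BoundedFormula.Realize]
    exact eq_iff_eq_of_cmp_eq_cmp this
  | rel R ts =>
    cases R with
    | lt =>
      obtain ⟨F1, h1⟩ := realize_term.{u, w} (ts 0)
      obtain ⟨F2, h2⟩ := realize_term.{u, w} (ts 1)
      refine ⟨F1 ∪ F2, fun M N _ _ _ _ hM hN P hP v v' xs xs' hv hxs => ?_⟩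
      have e : ∀ a, (Sum.elim v xs a, Sum.elim v' xs' a) ∈ P.val := by
        rintro (a | a)
        · exact hv a
        · exact hxs a
      have e1 := h1 M N P.val (fun i hi => hP i (by simp [hi])) _ _ e
      have e2 := h2 M N P.val (fun i hi => hP i (by simp [hi])) _ _ e
      have := P.prop _ e1 _ e2
      have k1 := hM.lt_iff ((ts 0).realize (Sum.elim v xs)) ((ts 1).realize (Sum.elim v xs))
      have k2 := hN.lt_iff ((ts 0).realize (Sum.elim v' xs')) ((ts 1).realize (Sum.elim v' xs'))
      have k3 := k1.trans ((lt_iff_lt_of_cmp_eq_cmp this).trans k2.symm)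
      have a1 : (fun i => (ts i).realize (Sum.elim v xs)) =
        ![(ts 0).realize (Sum.elim v xs), (ts 1).realize (Sum.elim v xs)] := by
        funext i; fin_cases i <;> rfl
      have a2 : (fun i => (ts i).realize (Sum.elim v' xs')) =
        ![(ts 0).realize (Sum.elim v' xs'), (ts 1).realize (Sum.elim v' xs')] := by
        funext i; fin_cases i <;> rfl
      rw [← a1, ← a2] at k3
      exact k3
  | imp φ ψ ih1 ih2 =>
    obtain ⟨F1, h1⟩ := ih1
    obtain ⟨F2, h2⟩ := ih2
    refine ⟨F1 ∪ F2, fun M N _ _ _ _ hM hN P hP v v' xs xs' hv hxs => ?_⟩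
    simp only [BoundedFormula.Realize]
    rw [h1 M N hM hN P (fun i hi => hP i (by simp [hi])) v v' xs xs' hv hxs,
      h2 M N hM hN P (fun i hi => hP i (by simp [hi])) v v' xs xs' hv hxs]
  | all φ ih =>
    obtain ⟨F, h⟩ := ih
    refine ⟨F, fun M N _ _ _ _ hM hN P hP v v' xs xs' hv hxs => ?_⟩
    have := hM.dense
    have := hM.nomin
    have := hM.nomax
    have := hM.ne
    have := hN.dense
    have := hN.nomin
    have := hN.nomax
    have := hN.ne
    have key : ∀ (Q : Order.PartialIso M N) (x : M) (y : N), P ≤ Q → (x, y) ∈ Q.val →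
        (φ.Realize v (Fin.snoc xs x) ↔ φ.Realize v' (Fin.snoc xs' y)) := by
      intro Q x y hQ hxy
      refine h M N hM hN Q (fun i hi => hQ (hP i hi)) v v' _ _ (fun a => hQ (hv a)) ?_
      intro a
      induction a using Fin.lastCases with
      | last => simpa using hxy
      | cast a => simpa using hQ (hxs a)
    simp only [BoundedFormula.Realize]
    constructor
    · intro hx y
      obtain ⟨Q, ⟨x, hxy⟩, hQ⟩ := (Order.PartialIso.definedAtRight M y).isCofinal P
      exact (key Q x y hQ hxy).1 (hx x)
    · intro hy x
      obtain ⟨Q, ⟨y, hxy⟩, hQ⟩ := (Order.PartialIso.definedAtLeft N x).isCofinal P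
      exact (key Q x y hQ hxy).2 (hy y)

theorem isMod_rat (g : I → ℚ) : @IsMod I g ℚ (mkStr g) _ :=
  isMod_mkStr g g (fun _ _ h => h) (fun _ _ h => h)

theorem isMod_model {g : I → ℚ} {M : Type u} [(Lg I).Structure M] [LinearOrder M]
    (hM : IsMod g M) : M ⊨ Th g := by
  classical
  let := mkStr g
  rw [Theory.model_iff]
  intro φ hφ
  have hφ' : (ℚ : Type) ⊨ φ := hφ
  obtain ⟨F, h⟩ := ef.{0, u} g φ
  have h0 := isMod_rat g
  let P : Order.PartialIso ℚ M := ⟨F.image (fun i => (cst ℚ i, cst M i)), by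
    intro p hp q hq
    rw [Finset.mem_image] at hp hq
    obtain ⟨i, _, rfl⟩ := hp
    obtain ⟨j, _, rfl⟩ := hq
    exact (h0.cst_cmp i j).trans (hM.cst_cmp i j).symm⟩
  have := h ℚ M h0 hM P (fun i hi => Finset.mem_image_of_mem _ hi) default default default default
    (fun a => a.elim) (fun a => a.elim0)
  have uq : ∀ (M : Type u) [(Lg I).Structure M] (v : Empty → M) (xs : Fin 0 → M),
      BoundedFormula.Realize φ v xs ↔ M ⊨ φ := by
    intro M _ v xs
    rw [Sentence.Realize, Formula.Realize, Subsingleton.elim v default, Subsingleton.elim xs default]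
  have uq' : ∀ (M : Type) [(Lg I).Structure M] (v : Empty → M) (xs : Fin 0 → M),
      BoundedFormula.Realize φ v xs ↔ M ⊨ φ := by
    intro M _ v xs
    rw [Sentence.Realize, Formula.Realize, Subsingleton.elim v default, Subsingleton.elim xs default]
  rw [uq, uq'] at this
  exact this.1 hφ'

theorem transfer {g : I → ℚ} {M : Type u} [(Lg I).Structure M] (hM : M ⊨ Th g)
    (φ : (Lg I).Sentence) (h : @Sentence.Realize (Lg I) ℚ (mkStr g) φ) : M ⊨ φ := 
  Theory.realize_sentence_of_mem (Th g) h

theorem exists_order {g : I → ℚ} {M : Type u} [(Lg I).Structure M] (hM : M ⊨ Th g) :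
    ∃ o : LinearOrder M, IsMod g M := by
  classical
  have tr := transfer hM
  let r : M → M → Prop := fun a b => Structure.RelMap (ltS I) ![a, b]
  let sq : (Lg I).Structure ℚ := mkStr g
  have rq : ∀ a b : ℚ, Structure.RelMap (ltS I) ![a, b] ↔ a < b := fun a b => Iff.rfl
  have h1 : ∀ a, ¬ r a a := by
    have := tr (∀' ∼ ((ltS I).boundedFormula₂ (&0) (&0))) (by
      simp [Sentence.Realize, Formula.Realize, BoundedFormula.realize_rel₂, rq])
    simpa [Sentence.Realize, Formula.Realize, BoundedFormula.realize_rel₂, Fin.snoc] using this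
  have h2 : ∀ a b c, r a b → r b c → r a c := by
    have := tr (∀' ∀' ∀' (((ltS I).boundedFormula₂ (&0) (&1)) ⟹
        (((ltS I).boundedFormula₂ (&1) (&2)) ⟹ ((ltS I).boundedFormula₂ (&0) (&2))))) (by
      simp [Sentence.Realize, Formula.Realize, BoundedFormula.realize_rel₂, rq, Fin.snoc]
      intro a b c; exact lt_trans)
    simpa [Sentence.Realize, Formula.Realize, BoundedFormula.realize_rel₂, Fin.snoc] using this
  have h3 : ∀ a b, r a b ∨ a = b ∨ r b a := by
    have := tr (∀' ∀' (((ltS I).boundedFormula₂ (&0) (&1)) ⊔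
        (((&0) =' (&1)) ⊔ ((ltS I).boundedFormula₂ (&1) (&0))))) (by
      simp [Sentence.Realize, Formula.Realize, BoundedFormula.realize_rel₂, rq, Fin.snoc]
      intro a b; exact lt_trichotomy a b)
    simpa [Sentence.Realize, Formula.Realize, BoundedFormula.realize_rel₂, Fin.snoc] using this
  have h4 : ∀ a b, r a b → ∃ c, r a c ∧ r c b := by
    have := tr (∀' ∀' (((ltS I).boundedFormula₂ (&0) (&1)) ⟹
        ∃' (((ltS I).boundedFormula₂ (&0) (&2)) ⊓ ((ltS I).boundedFormula₂ (&2) (&1))))) (by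
      simp [Sentence.Realize, Formula.Realize, BoundedFormula.realize_rel₂, rq, Fin.snoc]
      intro a b h; exact exists_between h)
    simpa [Sentence.Realize, Formula.Realize, BoundedFormula.realize_rel₂, Fin.snoc] using this
  have h5 : ∀ a, ∃ b, r a b := by
    have := tr (∀' ∃' ((ltS I).boundedFormula₂ (&0) (&1))) (by
      simp [Sentence.Realize, Formula.Realize, BoundedFormula.realize_rel₂, rq, Fin.snoc]
      intro a; exact exists_gt a)
    simpa [Sentence.Realize, Formula.Realize, BoundedFormula.realize_rel₂, Fin.snoc] using this
  have h6 : ∀ a, ∃ b, r b a := by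
    have := tr (∀' ∃' ((ltS I).boundedFormula₂ (&1) (&0))) (by
      simp [Sentence.Realize, Formula.Realize, BoundedFormula.realize_rel₂, rq, Fin.snoc]
      intro a; exact exists_lt a)
    simpa [Sentence.Realize, Formula.Realize, BoundedFormula.realize_rel₂, Fin.snoc] using this
  have h7 : ∃ a : M, a = a := by
    have := tr (∃' ((&0) =' (&0))) (by
      simp [Sentence.Realize, Formula.Realize])
    simpa [Sentence.Realize, Formula.Realize] using this
  have h8 : ∀ i j, g i < g j → r (cst M i) (cst M j) := by
    intro i j hij
    have := tr ((ltS I).boundedFormula₂ (Term.func (cS i) ![]) (Term.func (cS j) ![])) (by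
      simp only [Sentence.Realize, Formula.Realize, BoundedFormula.realize_rel₂, rq,
        BoundedFormula.realize_bdEqual]
      exact hij)
    simp only [Sentence.Realize, Formula.Realize, BoundedFormula.realize_rel₂,
      Term.realize] at this
    convert this using 3
    · unfold cst; congr 1; exact Subsingleton.elim _ _
    · unfold cst; congr 2; exact Subsingleton.elim _ _
  have h9 : ∀ i j, g i = g j → cst M i = cst M j := by
    intro i j hij
    have := tr (Term.bdEqual (Term.func (cS i) ![]) (Term.func (cS j) ![])) (by
      simp only [Sentence.Realize, Formula.Realize, BoundedFormula.realize_rel₂, rq,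
        BoundedFormula.realize_bdEqual]
      exact hij)
    simp only [Sentence.Realize, Formula.Realize, BoundedFormula.realize_bdEqual,
      Term.realize] at this
    convert this using 2
    · unfold cst; congr 1; exact Subsingleton.elim _ _
    · unfold cst; congr 1; exact Subsingleton.elim _ _
  have : IsStrictTotalOrder M r :=
    { irrefl := h1, trans := h2, trichotomous := fun a b hab hba => by
        rcases h3 a b with h | h | h
        · exact absurd h hab
        · exact h
        · exact absurd h hba }
  refine ⟨linearOrderOfSTO r, ?_⟩
  let := linearOrderOfSTO r
  exact ⟨fun a b => Iff.rfl, ⟨h4⟩, ⟨h6⟩, ⟨h5⟩, h7.nonempty, h8, h9⟩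

end Lang

section OMin
variable {I : Type}

theorem omin (g : I → ℚ) (M : Type w) [(Lg I).Structure M] (hM : M ⊨ Th g) :
    OMinimalStructure (ltS I) M := by
  classical
  obtain ⟨o, h⟩ := exists_order hM
  have hlt : ltInterp (ltS I) (M := M) = (· < ·) := by
    funext a b; exact propext (h.lt_iff a b)
  refine ⟨?_, ?_⟩
  · rw [hlt]
    exact ⟨fun a => lt_irrefl a, fun a b c => lt_trans, lt_trichotomy⟩
  · rw [hlt]
    rintro s ⟨k, φ, c, rfl⟩
    obtain ⟨F, hF⟩ := ef.{w, w} g φ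
    let E : Finset M := Finset.univ.image c ∪ F.image (cst M)
    have key : ∀ x y, (∀ e ∈ E, cmp e x = cmp e y) →
        (φ.Realize (Sum.elim c (fun _ => x)) ↔ φ.Realize (Sum.elim c (fun _ => y))) := by
      intro x y hxy
      let P : Order.PartialIso M M := ⟨insert (x, y) (E.image (fun e => (e, e))), by
        intro p hp q hq
        rw [Finset.mem_insert, Finset.mem_image] at hp hq
        rcases hp with rfl | ⟨e, he, rfl⟩ <;> rcases hq with rfl | ⟨e', he', rfl⟩
        · simp
        · rw [cmp_eq_cmp_symm]; exact hxy _ he'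
        · exact hxy _ he
        · rfl⟩
      have hE : ∀ e ∈ E, (e, e) ∈ P.val := fun e he =>
        Finset.mem_insert_of_mem (Finset.mem_image_of_mem (fun e => (e, e)) he)
      refine hF M M h h P (fun i hi => hE _ ?_) _ _ _ _ ?_ ?_
      · exact Finset.mem_union_right _ (Finset.mem_image_of_mem _ hi)
      · rintro (a | a)
        · exact hE _ (Finset.mem_union_left _ (Finset.mem_image_of_mem _ (Finset.mem_univ _)))
        · exact Finset.mem_insert_self _ _
      · intro a; exact a.elim0
    generalize hs : {x | φ.Realize (Sum.elim c (fun _ => x))} = s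
    have key' : ∀ x y, (∀ e ∈ E, cmp e x = cmp e y) → x ∈ s → y ∈ s := by
      intro x y hxy hx
      rw [← hs] at hx ⊢
      exact (key x y hxy).1 hx
    let C : Finset (Set M) := E.image (fun e => {e}) ∪
      (E.insertNone ×ˢ E.insertNone).image (fun p => OIntv (· < ·) p.1 p.2)
    let D : Finset (Set M) := C.filter (fun t => t ⊆ s)
    refine ⟨D.card, fun i => (D.equivFin.symm i).1, ?_, ?_⟩
    · ext x
      simp only [Set.mem_iUnion]
      constructor
      · intro hx
        suffices hh : ∃ t ∈ D, x ∈ t by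
          obtain ⟨t, ht, hxt⟩ := hh
          exact ⟨D.equivFin ⟨t, ht⟩, by simpa using hxt⟩
        by_cases hxE : x ∈ E
        · refine ⟨{x}, ?_, rfl⟩
          refine Finset.mem_filter.2 ⟨Finset.mem_union_left _ (Finset.mem_image.2 ⟨x, hxE, rfl⟩), ?_⟩
          simpa using hx
        · obtain ⟨a, haE, hax, ha⟩ : ∃ a ∈ E.insertNone, (∀ y ∈ a, y < x) ∧
              ∀ z, (∀ y ∈ a, y < z) → ∀ e ∈ E, e < x → e < z := by
            by_cases hn : (E.filter (· < x)).Nonempty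
            · have hm := Finset.max'_mem _ hn
              rw [Finset.mem_filter] at hm
              refine ⟨some _, Finset.some_mem_insertNone.2 hm.1, ?_, ?_⟩
              · intro y hy
                cases hy
                exact hm.2
              · intro z hz e he hex
                exact lt_of_le_of_lt (Finset.le_max' _ _ (Finset.mem_filter.2 ⟨he, hex⟩)) (hz _ rfl)
            · refine ⟨none, by simp, by simp, ?_⟩
              intro z _ e he hex
              exact absurd ⟨e, Finset.mem_filter.2 ⟨he, hex⟩⟩ hn
          obtain ⟨b, hbE, hbx, hb⟩ : ∃ a ∈ E.insertNone, (∀ y ∈ a, x < y) ∧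
              ∀ z, (∀ y ∈ a, z < y) → ∀ e ∈ E, x < e → z < e := by
            by_cases hn : (E.filter (x < ·)).Nonempty
            · have hm := Finset.min'_mem _ hn
              rw [Finset.mem_filter] at hm
              refine ⟨some _, Finset.some_mem_insertNone.2 hm.1, ?_, ?_⟩
              · intro y hy
                cases hy
                exact hm.2
              · intro z hz e he hex
                exact lt_of_lt_of_le (hz _ rfl) (Finset.min'_le _ _ (Finset.mem_filter.2 ⟨he, hex⟩))
            · refine ⟨none, by simp, by simp, ?_⟩
              intro z _ e he hex
              exact absurd ⟨e, Finset.mem_filter.2 ⟨he, hex⟩⟩ hn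
          refine ⟨OIntv (· < ·) a b, ?_, ⟨hax, hbx⟩⟩
          refine Finset.mem_filter.2 ⟨Finset.mem_union_right _ (Finset.mem_image.2
            ⟨(a, b), Finset.mem_product.2 ⟨haE, hbE⟩, rfl⟩), ?_⟩
          rintro z ⟨hz1, hz2⟩
          refine key' x z (fun e he => ?_) hx
          rcases lt_trichotomy e x with h1 | h1 | h1
          · rw [(cmp_eq_lt_iff _ _).2 h1, (cmp_eq_lt_iff _ _).2 (ha z hz1 e he h1)]
          · exact absurd (h1 ▸ he) hxE
          · rw [(cmp_eq_gt_iff _ _).2 h1, (cmp_eq_gt_iff _ _).2 (hb z hz2 e he h1)]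
      · rintro ⟨i, hi⟩
        have := (D.equivFin.symm i).2
        exact (Finset.mem_filter.1 this).2 hi
    · intro i
      have := (Finset.mem_filter.1 (D.equivFin.symm i).2).1
      rcases Finset.mem_union.1 this with h1 | h1
      · obtain ⟨e, _, he⟩ := Finset.mem_image.1 h1
        exact Or.inl ⟨e, he.symm⟩
      · obtain ⟨p, _, hp⟩ := Finset.mem_image.1 h1
        exact Or.inr ⟨p.1, p.2, hp.symm⟩

end OMin

section Glue

theorem glue {M N K : Type*} [LinearOrder M] [LinearOrder N] (t : M → K) (t' : N → K)
    (h : ∀ x y : M, x < y → t x ≠ t y → ∀ x' y', t' x' = t x → t' y' = t y → x' < y')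
    (e : ∀ k, Nonempty ({x // t x = k} ≃o {y // t' y = k})) :
    ∃ f : M ≃o N, ∀ x, t' (f x) = t x := by
  classical
  replace e := fun k => Classical.choice (e k)
  let f : M → N := fun x => (e (t x) ⟨x, rfl⟩).1
  have hf : ∀ k x (hx : t x = k), f x = (e k ⟨x, hx⟩).1 := by
    rintro k x rfl; rfl
  have hft : ∀ x, t' (f x) = t x := fun x => (e (t x) ⟨x, rfl⟩).2
  have hmono : StrictMono f := by
    intro x y hxy
    by_cases hk : t x = t y
    · rw [hf (t y) x hk, hf (t y) y rfl]
      exact (e (t y)).strictMono (Subtype.mk_lt_mk.2 hxy)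
    · exact h x y hxy hk _ _ (hft x) (hft y)
  have hsurj : Function.Surjective f := by
    intro y
    refine ⟨((e (t' y)).symm ⟨y, rfl⟩).1, ?_⟩
    rw [hf (t' y) _ ((e (t' y)).symm ⟨y, rfl⟩).2]
    simp
  exact ⟨hmono.orderIsoOfSurjective f hsurj, hft⟩

theorem sub_iso {X Y : Type*} [LinearOrder X] [LinearOrder Y] (hX : Subsingleton X)
    (hY : Subsingleton Y) (h : Nonempty X ↔ Nonempty Y) : Nonempty (X ≃o Y) := by
  by_cases hx : Nonempty X
  · obtain ⟨y⟩ := h.1 hx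
    obtain ⟨x⟩ := hx
    exact ⟨⟨⟨fun _ => y, fun _ => x, fun _ => Subsingleton.elim _ _, fun _ => Subsingleton.elim _ _⟩,
      by intro a b; simp [Subsingleton.elim a b]⟩⟩
  · have hy : ¬ Nonempty Y := fun hy => hx (h.2 hy)
    rw [not_nonempty_iff] at hx hy
    exact ⟨⟨Equiv.equivOfIsEmpty X Y, fun {a} => (hx.false a).elim⟩⟩

theorem fibTT (X : Type*) [LinearOrder X] :
    Nonempty {x : X // (IsBot x, IsTop x) = (True, True)} ↔ (Nonempty X ∧ ¬ Nontrivial X) := by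
  constructor
  · rintro ⟨x, hx⟩
    simp only [Prod.mk.injEq, eq_iff_iff, iff_true] at hx
    refine ⟨⟨x⟩, ?_⟩
    rintro ⟨a, b, hab⟩
    apply hab
    rw [le_antisymm (hx.2 a) (hx.1 a), le_antisymm (hx.2 b) (hx.1 b)]
  · rintro ⟨⟨x⟩, hn⟩
    rw [not_nontrivial_iff_subsingleton] at hn
    refine ⟨x, ?_⟩
    simp only [Prod.mk.injEq, eq_iff_iff, iff_true]
    exact ⟨fun y => (Subsingleton.elim x y).le, fun y => (Subsingleton.elim y x).le⟩

theorem fibTF (X : Type*) [LinearOrder X] :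
    Nonempty {x : X // (IsBot x, IsTop x) = (True, False)} ↔ ((∃ x : X, IsBot x) ∧ Nontrivial X) := by
  constructor
  · rintro ⟨x, hx⟩
    simp only [Prod.mk.injEq, eq_iff_iff, iff_true, iff_false] at hx
    refine ⟨⟨x, hx.1⟩, ?_⟩
    have h2 := hx.2
    simp only [IsTop, not_forall, not_le] at h2
    obtain ⟨y, hy⟩ := h2
    exact ⟨x, y, hy.ne⟩
  · rintro ⟨⟨x, hx⟩, hn⟩
    refine ⟨x, ?_⟩
    simp only [Prod.mk.injEq, eq_iff_iff, iff_true, iff_false]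
    refine ⟨hx, fun ht => ?_⟩
    obtain ⟨a, b, hab⟩ := hn
    apply hab
    rw [le_antisymm (ht a) (hx a), le_antisymm (ht b) (hx b)]

theorem fibFT (X : Type*) [LinearOrder X] :
    Nonempty {x : X // (IsBot x, IsTop x) = (False, True)} ↔ ((∃ x : X, IsTop x) ∧ Nontrivial X) := by
  constructor
  · rintro ⟨x, hx⟩
    simp only [Prod.mk.injEq, eq_iff_iff, iff_true, iff_false] at hx
    refine ⟨⟨x, hx.2⟩, ?_⟩
    have h2 := hx.1
    simp only [IsBot, not_forall, not_le] at h2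
    obtain ⟨y, hy⟩ := h2
    exact ⟨x, y, hy.ne'⟩
  · rintro ⟨⟨x, hx⟩, hn⟩
    refine ⟨x, ?_⟩
    simp only [Prod.mk.injEq, eq_iff_iff, iff_true, iff_false]
    refine ⟨fun ht => ?_, hx⟩
    obtain ⟨a, b, hab⟩ := hn
    apply hab
    rw [le_antisymm (hx a) (ht a), le_antisymm (hx b) (ht b)]

theorem fibFF (X : Type*) [LinearOrder X] [DenselyOrdered X] :
    Nonempty {x : X // (IsBot x, IsTop x) = (False, False)} ↔ Nontrivial X := by
  constructor
  · rintro ⟨x, hx⟩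
    simp only [Prod.mk.injEq, eq_iff_iff, iff_false] at hx
    have h2 := hx.1
    simp only [IsBot, not_forall, not_le] at h2
    obtain ⟨y, hy⟩ := h2
    exact ⟨x, y, hy.ne'⟩
  · intro hn
    obtain ⟨a, b, hab⟩ := exists_pair_lt X
    obtain ⟨c, hac, hcb⟩ := exists_between hab
    refine ⟨c, ?_⟩
    simp only [Prod.mk.injEq, eq_iff_iff, iff_false]
    exact ⟨fun h => (h a).not_gt hac, fun h => (h b).not_gt hcb⟩

theorem fibFF_inst (X : Type*) [LinearOrder X] [DenselyOrdered X] :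
    DenselyOrdered {x : X // (IsBot x, IsTop x) = (False, False)} ∧
    NoMinOrder {x : X // (IsBot x, IsTop x) = (False, False)} ∧
    NoMaxOrder {x : X // (IsBot x, IsTop x) = (False, False)} := by
  have key : ∀ a b c : X, a < b → b < c → (IsBot b, IsTop b) = (False, False) := by
    intro a b c hab hbc
    simp only [Prod.mk.injEq, eq_iff_iff, iff_false]
    exact ⟨fun h => (h a).not_gt hab, fun h => (h c).not_gt hbc⟩
  refine ⟨⟨?_⟩, ⟨?_⟩, ⟨?_⟩⟩
  · rintro ⟨a, ha⟩ ⟨b, hb⟩ hab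
    obtain ⟨c, h1, h2⟩ := exists_between (Subtype.mk_lt_mk.1 hab)
    exact ⟨⟨c, key a c b h1 h2⟩, h1, h2⟩
  · rintro ⟨a, ha⟩
    have ha' := ha
    simp only [Prod.mk.injEq, eq_iff_iff, iff_false, IsBot, not_forall, not_le] at ha'
    obtain ⟨⟨b, hb⟩, _⟩ := ha'
    obtain ⟨c, h1, h2⟩ := exists_between hb
    exact ⟨⟨c, key b c a h1 h2⟩, h2⟩
  · rintro ⟨a, ha⟩
    have ha' := ha
    simp only [Prod.mk.injEq, eq_iff_iff, iff_false, IsTop, not_forall, not_le] at ha'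
    obtain ⟨_, ⟨b, hb⟩⟩ := ha'
    obtain ⟨c, h1, h2⟩ := exists_between hb
    exact ⟨⟨c, key a c b h1 h2⟩, h1⟩

theorem shape_iso {X Y : Type*} [LinearOrder X] [LinearOrder Y] [DenselyOrdered X]
    [DenselyOrdered Y] [Countable X] [Countable Y] (h1 : Nonempty X ↔ Nonempty Y)
    (h2 : Nontrivial X ↔ Nontrivial Y) (h3 : (∃ x : X, IsBot x) ↔ ∃ x : Y, IsBot x)
    (h4 : (∃ x : X, IsTop x) ↔ ∃ x : Y, IsTop x) : Nonempty (X ≃o Y) := by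
  have sB : ∀ (Z : Type _) [LinearOrder Z] (q : Prop),
      Subsingleton {x : Z // (IsBot x, IsTop x) = (True, q)} := by
    intro Z _ q
    refine ⟨fun ⟨x, hx⟩ ⟨y, hy⟩ => Subtype.ext ?_⟩
    simp only [Prod.mk.injEq, eq_iff_iff, iff_true] at hx hy
    exact le_antisymm (hx.1 y) (hy.1 x)
  have sB' : ∀ (Z : Type _) [LinearOrder Z] (q : Prop),
      Subsingleton {x : Z // (IsBot x, IsTop x) = (True, q)} := by
    intro Z _ q
    refine ⟨fun ⟨x, hx⟩ ⟨y, hy⟩ => Subtype.ext ?_⟩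
    simp only [Prod.mk.injEq, eq_iff_iff, iff_true] at hx hy
    exact le_antisymm (hx.1 y) (hy.1 x)
  have sT : ∀ (Z : Type _) [LinearOrder Z] (q : Prop),
      Subsingleton {x : Z // (IsBot x, IsTop x) = (q, True)} := by
    intro Z _ q
    refine ⟨fun ⟨x, hx⟩ ⟨y, hy⟩ => Subtype.ext ?_⟩
    simp only [Prod.mk.injEq, eq_iff_iff, iff_true] at hx hy
    exact le_antisymm (hy.2 x) (hx.2 y)
  have sT' : ∀ (Z : Type _) [LinearOrder Z] (q : Prop),
      Subsingleton {x : Z // (IsBot x, IsTop x) = (q, True)} := by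
    intro Z _ q
    refine ⟨fun ⟨x, hx⟩ ⟨y, hy⟩ => Subtype.ext ?_⟩
    simp only [Prod.mk.injEq, eq_iff_iff, iff_true] at hx hy
    exact le_antisymm (hy.2 x) (hx.2 y)
  obtain ⟨f, _⟩ := glue (fun x : X => (IsBot x, IsTop x)) (fun x : Y => (IsBot x, IsTop x)) (by
    intro x y hxy hne x' y' hx' hy'
    have hne' : x' ≠ y' := by
      rintro rfl
      exact hne (hx'.symm.trans hy')
    have hne0 := hne
    simp only [Prod.mk.injEq, eq_iff_iff] at hx' hy'
    have nx : ¬ IsTop x := fun h => (h y).not_gt hxy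
    have ny : ¬ IsBot y := fun h => (h x).not_gt hxy
    refine lt_of_le_of_ne ?_ hne'
    by_cases hb : IsBot x
    · exact (hx'.1.2 hb) y'
    · by_cases ht : IsTop y
      · exact (hy'.2.2 ht) x'
      · exact absurd (by simp [hb, ny, nx, ht]) hne0) (by
    rintro ⟨p, q⟩
    by_cases hp : p
    · rw [eq_true hp]
      refine sub_iso (sB X q) (sB' Y q) ?_
      by_cases hq : q
      · rw [eq_true hq, fibTT, fibTT, h1, h2]
      · rw [eq_false hq, fibTF, fibTF, h3, h2]
    · rw [eq_false hp]
      by_cases hq : q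
      · rw [eq_true hq]
        refine sub_iso (sT X False) (sT' Y False) ?_
        rw [fibFT, fibFT, h4, h2]
      · rw [eq_false hq]
        by_cases hn : Nontrivial X
        · have := (fibFF X).2 hn
          have := (fibFF Y).2 (h2.1 hn)
          obtain ⟨_, _, _⟩ := fibFF_inst X
          obtain ⟨_, _, _⟩ := fibFF_inst Y
          exact Order.iso_of_countable_dense _ _
        · have a1 := mt (fibFF X).1 hn
          have a2 := mt (fibFF Y).1 (mt h2.2 hn)
          rw [not_nonempty_iff] at a1 a2
          exact sub_iso inferInstance inferInstance (iff_of_false (not_nonempty_iff.2 a1) (not_nonempty_iff.2 a2)))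
  exact ⟨f⟩

/-- Shape predicates of a subset of a linear order. -/
def SameShape {M N : Type*} [LinearOrder M] [LinearOrder N] (C : Set M) (D : Set N) : Prop :=
  (C.Nonempty ↔ D.Nonempty) ∧ (C.Nontrivial ↔ D.Nontrivial) ∧
  ((∃ x, IsLeast C x) ↔ ∃ x, IsLeast D x) ∧ ((∃ x, IsGreatest C x) ↔ ∃ x, IsGreatest D x)

theorem SameShape.iso {M N : Type*} [LinearOrder M] [LinearOrder N] [DenselyOrdered M]
    [DenselyOrdered N] [Countable M] [Countable N] {C : Set M} {D : Set N} (h : SameShape C D)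
    (hC : C.OrdConnected) (hD : D.OrdConnected) : Nonempty (C ≃o D) := by
  obtain ⟨h1, h2, h3, h4⟩ := h
  have eb : ∀ {Z : Type _} [LinearOrder Z] (S : Set Z), (∃ x : S, IsBot x) ↔ ∃ x, IsLeast S x := by
    intro Z _ S
    constructor
    · rintro ⟨⟨x, hx⟩, hb⟩; exact ⟨x, hx, fun y hy => hb ⟨y, hy⟩⟩
    · rintro ⟨x, hx, hb⟩; exact ⟨⟨x, hx⟩, fun y => hb y.2⟩
  have eb' : ∀ {Z : Type _} [LinearOrder Z] (S : Set Z), (∃ x : S, IsBot x) ↔ ∃ x, IsLeast S x := by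
    intro Z _ S
    constructor
    · rintro ⟨⟨x, hx⟩, hb⟩; exact ⟨x, hx, fun y hy => hb ⟨y, hy⟩⟩
    · rintro ⟨x, hx, hb⟩; exact ⟨⟨x, hx⟩, fun y => hb y.2⟩
  have et : ∀ {Z : Type _} [LinearOrder Z] (S : Set Z),
      (∃ x : S, IsTop x) ↔ ∃ x, IsGreatest S x := by
    intro Z _ S
    constructor
    · rintro ⟨⟨x, hx⟩, hb⟩; exact ⟨x, hx, fun y hy => hb ⟨y, hy⟩⟩
    · rintro ⟨x, hx, hb⟩; exact ⟨⟨x, hx⟩, fun y => hb y.2⟩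
  have et' : ∀ {Z : Type _} [LinearOrder Z] (S : Set Z),
      (∃ x : S, IsTop x) ↔ ∃ x, IsGreatest S x := by
    intro Z _ S
    constructor
    · rintro ⟨⟨x, hx⟩, hb⟩; exact ⟨x, hx, fun y hy => hb ⟨y, hy⟩⟩
    · rintro ⟨x, hx, hb⟩; exact ⟨⟨x, hx⟩, fun y => hb y.2⟩
  refine shape_iso ?_ ?_ ?_ ?_
  · rw [Set.nonempty_coe_sort, Set.nonempty_coe_sort, h1]
  · rw [Set.nontrivial_coe_sort, Set.nontrivial_coe_sort, h2]
  · rw [eb, eb', h3]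
  · rw [et, et', h4]

variable {I : Type}

/-- The convex set of a cut. -/
def cut (M : Type*) [(Lg I).Structure M] [LinearOrder M] (A : Set I) : Set M :=
  {x | (∀ i ∈ A, cst M i < x) ∧ ∀ i, i ∉ A → x < cst M i}

theorem cut_conn (M : Type*) [(Lg I).Structure M] [LinearOrder M] (A : Set I) :
    (cut M A).OrdConnected :=
  ⟨fun _ hx _ hy _ hz => ⟨fun i hi => (hx.1 i hi).trans_le hz.1,
    fun i hi => hz.2.trans_lt (hy.2 i hi)⟩⟩

theorem mod_iso {g : I → ℚ} {M N : Type*} [(Lg I).Structure M] [LinearOrder M]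
    [(Lg I).Structure N] [LinearOrder N] [Countable M] [Countable N] (hM : IsMod g M)
    (hN : IsMod g N) (h : ∀ A : Set I, SameShape (cut M A) (cut N A)) :
    Nonempty (M ≃[Lg I] N) := by
  have := hM.dense
  have := hN.dense
  let t : M → Set I × Set I := fun x => ({i | cst M i < x}, {i | cst M i ≤ x})
  let t' : N → Set I × Set I := fun x => ({i | cst N i < x}, {i | cst N i ≤ x})
  have ht : ∀ x A B, t x = (A, B) ↔ (∀ i, cst M i < x ↔ i ∈ A) ∧ (∀ i, cst M i ≤ x ↔ i ∈ B) := by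
    intro x A B
    simp [t, Set.ext_iff]
  have ht' : ∀ x A B, t' x = (A, B) ↔ (∀ i, cst N i < x ↔ i ∈ A) ∧ (∀ i, cst N i ≤ x ↔ i ∈ B) := by
    intro x A B
    simp [t', Set.ext_iff]
  have lt_cc : ∀ i j, cst M i < cst M j ↔ cst N i < cst N j := fun i j => by
    rw [hM.cst_lt_iff, hN.cst_lt_iff]
  have le_cc : ∀ i j, cst M i ≤ cst M j ↔ cst N i ≤ cst N j := fun i j => by
    rw [← not_lt, ← not_lt, lt_cc]
  obtain ⟨f, hf⟩ := glue t t' (by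
    intro x y hxy hne x' y' hx' hy'
    obtain ⟨a1, a2⟩ := (ht' _ _ _).1 hx'
    obtain ⟨b1, b2⟩ := (ht' _ _ _).1 hy'
    simp only [Set.mem_ofPred_eq] at a1 a2 b1 b2
    by_contra hc
    rw [not_lt] at hc
    apply hne
    have c1 : ∀ i, cst M i < x ↔ cst M i < y := fun i =>
      ⟨fun h => h.trans hxy, fun h => (a1 i).1 (((b1 i).2 h).trans_le hc)⟩
    have c2 : ∀ i, cst M i ≤ x ↔ cst M i ≤ y := fun i =>
      ⟨fun h => h.trans hxy.le, fun h => (a2 i).1 (((b2 i).2 h).trans hc)⟩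
    simp only [t, c1, c2]) (by
    rintro ⟨A, B⟩
    by_cases hAB : ∃ i, i ∈ B ∧ i ∉ A
    · obtain ⟨i, hiB, hiA⟩ := hAB
      have e1 : ∀ x, t x = (A, B) → x = cst M i := by
        intro x hx
        rw [ht] at hx
        exact le_antisymm (not_lt.1 (mt (hx.1 i).1 hiA)) ((hx.2 i).2 hiB)
      have e2 : ∀ x, t' x = (A, B) → x = cst N i := by
        intro x hx
        rw [ht'] at hx
        exact le_antisymm (not_lt.1 (mt (hx.1 i).1 hiA)) ((hx.2 i).2 hiB)
      refine sub_iso ⟨fun x y => Subtype.ext ((e1 _ x.2).trans (e1 _ y.2).symm)⟩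
        ⟨fun x y => Subtype.ext ((e2 _ x.2).trans (e2 _ y.2).symm)⟩ ⟨?_, ?_⟩
      · rintro ⟨x, hx⟩
        obtain rfl := e1 x hx
        refine ⟨cst N i, ?_⟩
        rw [ht] at hx
        rw [ht']
        exact ⟨fun j => (lt_cc j i).symm.trans (hx.1 j), fun j => (le_cc j i).symm.trans (hx.2 j)⟩
      · rintro ⟨x, hx⟩
        obtain rfl := e2 x hx
        refine ⟨cst M i, ?_⟩
        rw [ht'] at hx
        rw [ht]
        exact ⟨fun j => (lt_cc j i).trans (hx.1 j), fun j => (le_cc j i).trans (hx.2 j)⟩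
    · push Not at hAB
      by_cases hBA : ∃ i, i ∈ A ∧ i ∉ B
      · obtain ⟨i, hiA, hiB⟩ := hBA
        have e1 : IsEmpty {x // t x = (A, B)} := ⟨fun ⟨x, hx⟩ => by
          rw [ht] at hx
          exact hiB ((hx.2 i).1 ((hx.1 i).2 hiA).le)⟩
        have e2 : IsEmpty {x // t' x = (A, B)} := ⟨fun ⟨x, hx⟩ => by
          rw [ht'] at hx
          exact hiB ((hx.2 i).1 ((hx.1 i).2 hiA).le)⟩
        exact sub_iso inferInstance inferInstance (iff_of_false (not_nonempty_iff.2 e1) (not_nonempty_iff.2 e2))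
      · push Not at hBA
        obtain rfl : A = B := Set.ext fun i => ⟨hBA i, hAB i⟩
        have e1 : ∀ x, t x = (A, A) ↔ x ∈ cut M A := by
          intro x
          rw [ht]
          constructor
          · rintro ⟨h1, h2⟩
            exact ⟨fun i hi => (h1 i).2 hi, fun i hi => not_le.1 (mt (h2 i).1 hi)⟩
          · rintro ⟨h1, h2⟩
            exact ⟨fun i => ⟨fun h => by_contra fun hi => (h2 i hi).asymm h, h1 i⟩,
              fun i => ⟨fun h => by_contra fun hi => (h2 i hi).not_ge h, fun hi => (h1 i hi).le⟩⟩
        have e2 : ∀ x, t' x = (A, A) ↔ x ∈ cut N A := by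
          intro x
          rw [ht']
          constructor
          · rintro ⟨h1, h2⟩
            exact ⟨fun i hi => (h1 i).2 hi, fun i hi => not_le.1 (mt (h2 i).1 hi)⟩
          · rintro ⟨h1, h2⟩
            exact ⟨fun i => ⟨fun h => by_contra fun hi => (h2 i hi).asymm h, h1 i⟩,
              fun i => ⟨fun h => by_contra fun hi => (h2 i hi).not_ge h, fun hi => (h1 i hi).le⟩⟩
        obtain ⟨u⟩ := (h A).iso (cut_conn M A) (cut_conn N A)
        exact ⟨((OrderIso.setCongr {x | t x = (A, A)} (cut M A) (Set.ext e1)).trans u).trans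
          (OrderIso.setCongr {x | t' x = (A, A)} (cut N A) (Set.ext e2)).symm⟩)
  have hfc : ∀ i : I, f (cst M i) = cst N i := by
    intro i
    obtain ⟨a1, a2⟩ := (ht' _ _ _).1 (hf (cst M i))
    exact le_antisymm (not_lt.1 (mt (a1 i).1 (lt_irrefl (cst M i)))) ((a2 i).2 (le_refl (cst M i)))
  refine ⟨⟨f.toEquiv, ?_, ?_⟩⟩
  · intro n s x
    cases s with
    | c i =>
      have := hfc i
      unfold cst cS at this
      rw [Subsingleton.elim x (![])]
      change f (Structure.funMap (cS i) (![])) = Structure.funMap (cS i) (f ∘ (![]))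
      unfold cS
      rw [Subsingleton.elim (f ∘ (![])) (![] : Fin 0 → N)]
      exact this
  · intro n r x
    cases r with
    | lt =>
      have h1 := hM.lt_iff (x 0) (x 1)
      have h2 := hN.lt_iff (f (x 0)) (f (x 1))
      have e1 : ![x 0, x 1] = x := by funext i; fin_cases i <;> rfl
      have e2 : ![f (x 0), f (x 1)] = f ∘ x := by funext i; fin_cases i <;> rfl
      rw [e1] at h1
      rw [e2] at h2
      exact h2.trans (f.lt_iff_lt.trans h1.symm)

end Glue

section Count

/-- Index set of constants. -/
abbrev Ix (m : ℕ) : Type := Fin m × ℕ × Bool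

/-- Position of the constants. -/
def gq {m : ℕ} (six : Fin m → Bool) (r : Fin m → ℚ) : Ix m → ℚ
  | (j, n, false) => 10 * ((j : ℕ) : ℚ) - 1 / ((n : ℚ) + 1)
  | (j, n, true) => 10 * ((j : ℕ) : ℚ) + r j + (if six j = true then 1 / ((n : ℚ) + 1) else 0)

variable {m : ℕ} {six : Fin m → Bool}

theorem inv_bd (n : ℕ) : 0 < 1 / ((n : ℚ) + 1) ∧ 1 / ((n : ℚ) + 1) ≤ 1 := by
  refine ⟨by positivity, ?_⟩
  rw [div_le_one (by positivity)]
  have : (0 : ℚ) ≤ n := by positivity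
  linarith

theorem gq_bd {r : Fin m → ℚ} (hr : ∀ j, 0 ≤ r j ∧ r j ≤ 1) (j : Fin m) (n : ℕ) (b : Bool) :
    10 * ((j : ℕ) : ℚ) - 1 ≤ gq six r (j, n, b) ∧ gq six r (j, n, b) ≤ 10 * ((j : ℕ) : ℚ) + 2 := by
  have h1 := inv_bd n
  have h2 := hr j
  cases b
  · simp only [gq]
    constructor <;> linarith
  · simp only [gq]
    split_ifs <;> constructor <;> linarith

theorem gq_blk {r : Fin m → ℚ} (hr : ∀ j, 0 ≤ r j ∧ r j ≤ 1) {j j' : Fin m} (hj : j < j')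
    (n n' : ℕ) (b b' : Bool) : gq six r (j, n, b) < gq six r (j', n', b') := by
  have h1 := (gq_bd (six := six) hr j n b).2
  have h2 := (gq_bd (six := six) hr j' n' b').1
  have h3 : ((j : ℕ) : ℚ) + 1 ≤ ((j' : ℕ) : ℚ) := by
    have : (j : ℕ) + 1 ≤ (j' : ℕ) := hj
    exact_mod_cast this
  linarith

theorem gq_ft {r : Fin m → ℚ} (hr : ∀ j, 0 ≤ r j ∧ r j ≤ 1) (j : Fin m)
    (n n' : ℕ) : gq six r (j, n, false) < gq six r (j, n', true) := by
  have h1 := inv_bd n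
  have h1' := inv_bd n'
  have h2 := hr j
  simp only [gq]
  split_ifs <;> linarith

theorem gq_lt {r r' : Fin m → ℚ} (hr : ∀ j, 0 ≤ r j ∧ r j ≤ 1) (hr' : ∀ j, 0 ≤ r' j ∧ r' j ≤ 1)
    (i i' : Ix m) (h : gq six r i < gq six r i') : gq six r' i < gq six r' i' := by
  obtain ⟨j, n, b⟩ := i
  obtain ⟨j', n', b'⟩ := i'
  rcases lt_trichotomy j j' with hj | rfl | hj
  · exact gq_blk hr' hj _ _ _ _
  · cases b <;> cases b'
    · exact h
    · exact gq_ft hr' _ _ _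
    · exact absurd h (gq_ft hr _ _ _).asymm
    · simp only [gq] at h ⊢
      linarith
  · exact absurd h (gq_blk hr hj _ _ _ _).asymm

theorem gq_eq {r r' : Fin m → ℚ} (hr : ∀ j, 0 ≤ r j ∧ r j ≤ 1) (hr' : ∀ j, 0 ≤ r' j ∧ r' j ≤ 1)
    (i i' : Ix m) (h : gq six r i = gq six r i') : gq six r' i = gq six r' i' := by
  rcases lt_trichotomy (gq six r' i) (gq six r' i') with h1 | h1 | h1
  · exact absurd h (gq_lt hr' hr _ _ h1).ne
  · exact h1
  · exact absurd h (gq_lt hr' hr _ _ h1).ne'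

theorem gq_ff {r : Fin m → ℚ} (j : Fin m) {n n' : ℕ} (h : n ≤ n') :
    gq six r (j, n, false) ≤ gq six r (j, n', false) := by
  have : 1 / ((n' : ℚ) + 1) ≤ 1 / ((n : ℚ) + 1) := by
    have : (n : ℚ) ≤ n' := by exact_mod_cast h
    gcongr
  simp only [gq]
  linarith

theorem gq_tt {r : Fin m → ℚ} (j : Fin m) {n n' : ℕ} (h : n ≤ n') :
    gq six r (j, n', true) ≤ gq six r (j, n, true) := by
  have : 1 / ((n' : ℚ) + 1) ≤ 1 / ((n : ℚ) + 1) := by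
    have : (n : ℚ) ≤ n' := by exact_mod_cast h
    gcongr
  simp only [gq]
  split_ifs <;> linarith

/-- base position -/
def g0 (six : Fin m → Bool) : Ix m → ℚ := gq six (fun _ => 1)

theorem one_bd : ∀ j : Fin m, (0 : ℚ) ≤ (fun _ : Fin m => (1 : ℚ)) j ∧
    (fun _ : Fin m => (1 : ℚ)) j ≤ 1 := fun j => ⟨zero_le_one, le_refl _⟩

/-- The nonisolated cuts. -/
def cutSet (j : Fin m) : Set (Ix m) := {i | i.1 < j ∨ (i.1 = j ∧ i.2.2 = false)}

theorem classify (A : Set (Ix m)) (hd : ∀ i i', i ∈ A → g0 six i' ≤ g0 six i → i' ∈ A)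
    (hA : ∀ j, A ≠ cutSet j) :
    (A = ∅ ∨ ∃ i ∈ A, ∀ i' ∈ A, g0 six i' ≤ g0 six i) ∧
    (A = Set.univ ∨ ∃ i, i ∉ A ∧ ∀ i', i' ∉ A → g0 six i ≤ g0 six i') := by
  classical
  constructor
  · rcases A.eq_empty_or_nonempty with h | ⟨⟨j0, n0, b0⟩, h0⟩
    · exact Or.inl h
    right
    obtain ⟨j, ⟨n, b, hj⟩, hmax⟩ := Set.exists_max_image {j : Fin m | ∃ n b, (j, n, b) ∈ A} id
      (Set.toFinite _) ⟨j0, n0, b0, h0⟩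
    have hmax' : ∀ j' n' b', (j', n', b') ∈ A → j' ≤ j := fun j' n' b' h => hmax j' ⟨n', b', h⟩
    by_cases ht : ∃ n, (j, n, true) ∈ A
    · refine ⟨(j, Nat.find ht, true), Nat.find_spec ht, ?_⟩
      rintro ⟨j', n', b'⟩ hi'
      rcases (hmax' _ _ _ hi').lt_or_eq with h | rfl
      · exact (gq_blk one_bd h _ _ _ _).le
      · cases b'
        · exact (gq_ft one_bd _ _ _).le
        · exact gq_tt _ (Nat.find_min' ht hi')
    · push Not at ht
      have hf : ∃ n, (j, n, false) ∉ A := by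
        by_contra hf
        push Not at hf
        apply hA j
        ext ⟨j', n', b'⟩
        constructor
        · intro hi'
          rcases (hmax' _ _ _ hi').lt_or_eq with h | rfl
          · exact Or.inl h
          · cases b'
            · exact Or.inr ⟨rfl, rfl⟩
            · exact absurd hi' (ht _)
        · rintro (h | ⟨h1, h2⟩)
          · exact hd _ _ (hf 0) (gq_blk one_bd h _ _ _ _).le
          · simp only at h1 h2
            subst h1 h2
            exact hf _
      have hspec := Nat.find_spec hf
      rcases hn : Nat.find hf with _ | n1
      · rw [hn] at hspec
        cases b
        · exact absurd (hd _ _ hj (gq_ff _ (Nat.zero_le _))) hspec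
        · exact absurd hj (ht _)
      · rw [hn] at hspec
        refine ⟨(j, n1, false), not_not.1 (Nat.find_min hf (by omega)), ?_⟩
        rintro ⟨j', n', b'⟩ hi'
        rcases (hmax' _ _ _ hi').lt_or_eq with h | rfl
        · exact (gq_blk one_bd h _ _ _ _).le
        · cases b'
          · apply gq_ff
            by_contra hlt
            exact hspec (hd _ _ hi' (gq_ff _ (by omega)))
          · exact absurd hi' (ht _)
  · by_cases hu : A = Set.univ
    · exact Or.inl hu
    right
    obtain ⟨⟨j0, n0, b0⟩, h0⟩ := (Set.ne_univ_iff_exists_notMem A).1 hu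
    obtain ⟨j, ⟨n, b, hj⟩, hmin⟩ := Set.exists_min_image {j : Fin m | ∃ n b, (j, n, b) ∉ A} id
      (Set.toFinite _) ⟨j0, n0, b0, h0⟩
    have hmin' : ∀ j' n' b', (j', n', b') ∉ A → j ≤ j' := fun j' n' b' h => hmin j' ⟨n', b', h⟩
    by_cases ht : ∃ n, (j, n, false) ∉ A
    · refine ⟨(j, Nat.find ht, false), Nat.find_spec ht, ?_⟩
      rintro ⟨j', n', b'⟩ hi'
      rcases (hmin' _ _ _ hi').lt_or_eq with h | rfl
      · exact (gq_blk one_bd h _ _ _ _).le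
      · cases b'
        · exact gq_ff _ (Nat.find_min' ht hi')
        · exact (gq_ft one_bd _ _ _).le
    · push Not at ht
      have hf : ∃ n, (j, n, true) ∈ A := by
        by_contra hf
        push Not at hf
        apply hA j
        ext ⟨j', n', b'⟩
        constructor
        · intro hi'
          rcases lt_trichotomy j' j with h | rfl | h
          · exact Or.inl h
          · cases b'
            · exact Or.inr ⟨rfl, rfl⟩
            · exact absurd hi' (hf _)
          · exact absurd (hd _ _ hi' (gq_blk one_bd h 0 _ true _).le) (hf _)
        · rintro (h | ⟨h1, h2⟩)
          · by_contra hc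
            exact absurd h (hmin' _ _ _ hc).not_gt
          · simp only at h1 h2
            subst h1 h2
            exact ht _
      have hspec := Nat.find_spec hf
      rcases hn : Nat.find hf with _ | n1
      · rw [hn] at hspec
        cases b
        · exact absurd (ht _) hj
        · exact absurd (hd _ _ hspec (gq_tt _ (Nat.zero_le _))) hj
      · rw [hn] at hspec
        refine ⟨(j, n1, true), Nat.find_min hf (by omega), ?_⟩
        rintro ⟨j', n', b'⟩ hi'
        rcases (hmin' _ _ _ hi').lt_or_eq with h | rfl
        · exact (gq_blk one_bd h _ _ _ _).le
        · cases b'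
          · exact absurd (ht _) hi'
          · apply gq_tt
            by_contra hlt
            exact hi' (hd _ _ hspec (gq_tt _ (by omega)))

theorem IsMod.cst_le {I : Type} {g : I → ℚ} {M : Type*} [(Lg I).Structure M] [LinearOrder M]
    (h : IsMod g M) {i j : I} (hij : g i ≤ g j) : cst M i ≤ cst M j := by
  rw [← not_lt, h.cst_lt_iff, not_lt]
  exact hij

theorem nice_cut {I : Type} {g : I → ℚ} {M : Type*} [(Lg I).Structure M] [LinearOrder M]
    (h : IsMod g M) (A : Set I) (hd : ∀ i i', i ∈ A → g i' ≤ g i → i' ∈ A)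
    (h1 : A = ∅ ∨ ∃ i ∈ A, ∀ i' ∈ A, g i' ≤ g i)
    (h2 : A = Set.univ ∨ ∃ i, i ∉ A ∧ ∀ i', i' ∉ A → g i ≤ g i') :
    (cut M A).Nonempty ∧ (cut M A).Nontrivial ∧ (¬ ∃ x, IsLeast (cut M A) x) ∧
      ¬ ∃ x, IsGreatest (cut M A) x := by
  have := h.dense
  have := h.nomin
  have := h.nomax
  have := h.ne
  have noleast : ∀ x ∈ cut M A, ∃ y ∈ cut M A, y < x := by
    rintro x ⟨hx1, hx2⟩
    rcases h1 with rfl | ⟨i, hi, him⟩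
    · obtain ⟨y, hy⟩ := exists_lt x
      exact ⟨y, ⟨fun i hi => hi.elim, fun i hi => hy.trans (hx2 i hi)⟩, hy⟩
    · obtain ⟨y, hy1, hy2⟩ := exists_between (hx1 i hi)
      exact ⟨y, ⟨fun j hj => (h.cst_le (him j hj)).trans_lt hy1, fun i hi => hy2.trans (hx2 i hi)⟩, hy2⟩
  have nogreat : ∀ x ∈ cut M A, ∃ y ∈ cut M A, x < y := by
    rintro x ⟨hx1, hx2⟩
    rcases h2 with rfl | ⟨i, hi, him⟩
    · obtain ⟨y, hy⟩ := exists_gt x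
      exact ⟨y, ⟨fun i hi => (hx1 i hi).trans hy, fun i hi => (hi trivial).elim⟩, hy⟩
    · obtain ⟨y, hy1, hy2⟩ := exists_between (hx2 i hi)
      exact ⟨y, ⟨fun j hj => (hx1 j hj).trans hy1, fun j hj => hy2.trans_le (h.cst_le (him j hj))⟩, hy1⟩
  have hne : (cut M A).Nonempty := by
    rcases h1 with h1 | ⟨i, hi, him⟩
    · rcases h2 with h2 | ⟨i', hi', him'⟩
      · obtain ⟨x⟩ := h.ne
        refine ⟨x, fun i hi => ?_, fun i hi => ?_⟩
        · rw [h1] at hi; exact hi.elim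
        · rw [h2] at hi; exact (hi trivial).elim
      · obtain ⟨x, hx⟩ := exists_lt (cst M i')
        refine ⟨x, fun i hi => ?_, fun j hj => hx.trans_le (h.cst_le (him' j hj))⟩
        rw [h1] at hi; exact hi.elim
    · rcases h2 with h2 | ⟨i', hi', him'⟩
      · obtain ⟨x, hx⟩ := exists_gt (cst M i)
        refine ⟨x, fun j hj => (h.cst_le (him j hj)).trans_lt hx, fun i hi => ?_⟩
        rw [h2] at hi; exact (hi trivial).elim
      · have hlt : g i < g i' := by
          by_contra hc
          exact hi' (hd i i' hi (not_lt.1 hc))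
        obtain ⟨x, hx1, hx2⟩ := exists_between (h.cst_lt _ _ hlt)
        exact ⟨x, fun j hj => (h.cst_le (him j hj)).trans_lt hx1,
          fun j hj => hx2.trans_le (h.cst_le (him' j hj))⟩
  refine ⟨hne, ?_, ?_, ?_⟩
  · obtain ⟨x, hx⟩ := hne
    obtain ⟨y, hy, hyx⟩ := noleast x hx
    exact ⟨x, hx, y, hy, hyx.ne'⟩
  · rintro ⟨x, hx, hl⟩
    obtain ⟨y, hy, hyx⟩ := noleast x hx
    exact (hl hy).not_gt hyx
  · rintro ⟨x, hx, hl⟩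
    obtain ⟨y, hy, hyx⟩ := nogreat x hx
    exact (hl hy).not_gt hyx

theorem cut_empty {I : Type} {g : I → ℚ} {M : Type*} [(Lg I).Structure M] [LinearOrder M]
    (h : IsMod g M) (A : Set I) (hd : ¬ ∀ i i', i ∈ A → g i' ≤ g i → i' ∈ A) : cut M A = ∅ := by
  push Not at hd
  obtain ⟨i, i', h1, h2, h3⟩ := hd
  rw [Set.eq_empty_iff_forall_notMem]
  rintro x ⟨hx1, hx2⟩
  exact (h.cst_le h2).not_gt ((hx1 i h1).trans (hx2 i' h3))

theorem all_same {M N : Type*} [(Lg (Ix m)).Structure M] [LinearOrder M]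
    [(Lg (Ix m)).Structure N] [LinearOrder N] (hM : IsMod (g0 six) M) (hN : IsMod (g0 six) N)
    (h : ∀ j : Fin m, SameShape (cut M (cutSet j)) (cut N (cutSet j))) (A : Set (Ix m)) :
    SameShape (cut M A) (cut N A) := by
  by_cases hd : ∀ i i', i ∈ A → g0 six i' ≤ g0 six i → i' ∈ A
  · by_cases hA : ∃ j, A = cutSet j
    · obtain ⟨j, rfl⟩ := hA
      exact h j
    · push Not at hA
      obtain ⟨h1, h2⟩ := classify A hd hA
      obtain ⟨a1, a2, a3, a4⟩ := nice_cut hM A hd h1 h2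
      obtain ⟨b1, b2, b3, b4⟩ := nice_cut hN A hd h1 h2
      exact ⟨iff_of_true a1 b1, iff_of_true a2 b2, iff_of_false a3 b3, iff_of_false a4 b4⟩
  · rw [cut_empty hM A hd, cut_empty hN A hd]
    simp [SameShape, IsLeast, IsGreatest]

theorem iso_same {I : Type} {g : I → ℚ} {M N : Type*} [(Lg I).Structure M] [LinearOrder M]
    [(Lg I).Structure N] [LinearOrder N] (hM : IsMod g M)
    (hN : IsMod g N) (e : M ≃[Lg I] N) (A : Set I) : SameShape (cut M A) (cut N A) := by
  have hlt : ∀ a b, e a < e b ↔ a < b := by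
    intro a b
    rw [← hM.lt_iff, ← hN.lt_iff, ← e.map_rel]
    have : ![e a, e b] = e ∘ ![a, b] := by funext i; fin_cases i <;> rfl
    rw [this]
  have hle : ∀ a b, e a ≤ e b ↔ a ≤ b := by
    intro a b
    rw [← not_lt, hlt, not_lt]
  have hc : ∀ i : I, e (cst M i) = cst N i := by
    intro i
    unfold cst
    rw [e.map_fun]
    congr 1
    exact Subsingleton.elim _ _
  have hm : ∀ x, e x ∈ cut N A ↔ x ∈ cut M A := by
    intro x
    simp only [cut, Set.mem_ofPred_eq, ← hc, hlt]
  have hm' : ∀ y, y ∈ cut N A ↔ e.symm y ∈ cut M A := by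
    intro y
    rw [← hm]; simp
  have hsurj : Function.Surjective e := e.surjective
  have him : cut N A = e '' cut M A := by
    ext y
    obtain ⟨x, rfl⟩ := hsurj y
    rw [hm, e.injective.mem_set_image]
  rw [him]
  refine ⟨Set.image_nonempty.symm, (Set.image_nontrivial e.injective).symm, ?_, ?_⟩
  · constructor
    · rintro ⟨x, hx, hl⟩
      refine ⟨e x, ⟨x, hx, rfl⟩, ?_⟩
      rintro _ ⟨y, hy, rfl⟩
      exact (hle _ _).2 (hl hy)
    · rintro ⟨_, ⟨x, hx, rfl⟩, hl⟩
      exact ⟨x, hx, fun y hy => (hle _ _).1 (hl ⟨y, hy, rfl⟩)⟩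
  · constructor
    · rintro ⟨x, hx, hl⟩
      refine ⟨e x, ⟨x, hx, rfl⟩, ?_⟩
      rintro _ ⟨y, hy, rfl⟩
      exact (hle _ _).2 (hl hy)
    · rintro ⟨_, ⟨x, hx, rfl⟩, hl⟩
      exact ⟨x, hx, fun y hy => (hle _ _).1 (hl ⟨y, hy, rfl⟩)⟩

/-- codes -/
abbrev Cd : Type := Bool × Bool × Bool × Bool

open scoped Classical in
/-- code of a set -/
noncomputable def code {M : Type*} [LinearOrder M] (C : Set M) : Cd :=
  (decide C.Nonempty, decide C.Nontrivial, decide (∃ x, IsLeast C x), decide (∃ x, IsGreatest C x))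

theorem code_eq_iff {M N : Type*} [LinearOrder M] [LinearOrder N] (C : Set M) (D : Set N) :
    code C = code D ↔ SameShape C D := by
  simp only [code, SameShape, Prod.mk.injEq, decide_eq_decide]

/-- the allowed codes -/
def allowed (s : Bool) : Finset Cd := Finset.univ.filter (fun c =>
  if s = true then (c.2.1 = true → c.1 = true) ∧ (c.2.1 = false → c.2.2.1 = c.1 ∧ c.2.2.2 = c.1)
  else c.1 = c.2.1 ∧ c.2.2.2 = false ∧ (c.2.2.1 = true → c.1 = true))

theorem allowed_card (s : Bool) : (allowed s).card = if s = true then 6 else 3 := by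
  cases s <;> decide

theorem code_mem {M : Type*} [(Lg (Ix m)).Structure M] [LinearOrder M]
    (hM : IsMod (g0 six) M) (j : Fin m) : code (cut M (cutSet j)) ∈ allowed (six j) := by
  classical
  have hnn : (cut M (cutSet j)).Nontrivial → (cut M (cutSet j)).Nonempty := fun h => h.nonempty
  unfold allowed
  rw [Finset.mem_filter]
  refine ⟨Finset.mem_univ _, ?_⟩
  by_cases hs : six j = true
  · rw [if_pos hs]
    simp only [code, decide_eq_true_eq, decide_eq_false_iff_not, decide_eq_decide]
    refine ⟨hnn, fun ht => ⟨⟨fun ⟨x, hx⟩ => ⟨x, hx.1⟩, fun ⟨x, hx⟩ => ?_⟩,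
      ⟨fun ⟨x, hx⟩ => ⟨x, hx.1⟩, fun ⟨x, hx⟩ => ?_⟩⟩⟩
    · rw [Set.not_nontrivial_iff] at ht
      exact ⟨x, hx, fun y hy => (ht hx hy).le⟩
    · rw [Set.not_nontrivial_iff] at ht
      exact ⟨x, hx, fun y hy => (ht hx hy).ge⟩
  · rw [if_neg hs]
    simp only [code, decide_eq_true_eq, decide_eq_false_iff_not, decide_eq_decide]
    have := hM.dense
    have key : ∀ x ∈ cut M (cutSet j), ∃ y ∈ cut M (cutSet j), x < y := by
      rintro x ⟨hx1, hx2⟩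
      have hnot : ∀ n, ((j, n, true) : Ix m) ∉ cutSet j := by
        rintro n (h | ⟨_, h⟩)
        · exact lt_irrefl _ h
        · simp at h
      obtain ⟨y, hy1, hy2⟩ := exists_between (hx2 (j, 0, true) (hnot 0))
      refine ⟨y, ⟨fun i hi => (hx1 i hi).trans hy1, fun i hi => hy2.trans_le (hM.cst_le ?_)⟩, hy1⟩
      obtain ⟨j', n', b'⟩ := i
      rcases lt_trichotomy j' j with h | rfl | h
      · exact absurd (Or.inl h) hi
      · cases b'
        · exact absurd (Or.inr ⟨rfl, rfl⟩) hi
        · simp [g0, gq, hs]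
      · exact (gq_blk one_bd h _ _ _ _).le
    refine ⟨⟨?_, hnn⟩, ?_, ?_⟩
    · rintro ⟨x, hx⟩
      obtain ⟨y, hy, hxy⟩ := key x hx
      exact ⟨x, hx, y, hy, hxy.ne⟩
    · rintro ⟨x, hx, hg⟩
      obtain ⟨y, hy, hxy⟩ := key x hx
      exact (hg hy).not_gt hxy
    · rintro ⟨x, hx⟩
      exact ⟨x, hx.1⟩

section Realize

/-- width -/
def wd (f : Fin m → Cd) (j : Fin m) : ℚ := if (f j).2.1 = true then 1 else 0

theorem wd_bd (f : Fin m → Cd) (j : Fin m) : 0 ≤ wd f j ∧ wd f j ≤ 1 := by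
  unfold wd; split_ifs <;> norm_num

/-- local removal condition -/
def rem1 (six : Fin m → Bool) (f : Fin m → Cd) (j : Fin m) (x : ℚ) : Prop :=
  (x = 10 * ((j : ℕ) : ℚ) ∧ (f j).2.2.1 = false ∧ (six j = true ∨ (f j).2.1 = true)) ∨
  (x = 10 * ((j : ℕ) : ℚ) + wd f j ∧ (f j).2.2.2 = false ∧ six j = true)

/-- removed points -/
def Rem (six : Fin m → Bool) (f : Fin m → Cd) : Set ℚ := {x | ∃ j, rem1 six f j x}

theorem Rem_finite (f : Fin m → Cd) : (Rem six f).Finite := by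
  refine ((Set.finite_range (fun j : Fin m => 10 * ((j : ℕ) : ℚ))).union
    (Set.finite_range (fun j : Fin m => 10 * ((j : ℕ) : ℚ) + wd f j))).subset ?_
  rintro x ⟨j, ⟨h, _⟩ | ⟨h, _⟩⟩
  · exact Or.inl ⟨j, h.symm⟩
  · exact Or.inr ⟨j, h.symm⟩

theorem Rem_blk (f : Fin m → Cd) (j : Fin m) {x : ℚ} (h1 : 10 * ((j : ℕ) : ℚ) - 1 ≤ x)
    (h2 : x ≤ 10 * ((j : ℕ) : ℚ) + 2) : x ∈ Rem six f ↔ rem1 six f j x := by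
  refine ⟨?_, fun h => ⟨j, h⟩⟩
  rintro ⟨j', hj'⟩
  have hb : 10 * ((j' : ℕ) : ℚ) ≤ x ∧ x ≤ 10 * ((j' : ℕ) : ℚ) + 1 := by
    have := wd_bd f j'
    rcases hj' with ⟨h, _⟩ | ⟨h, _⟩ <;> constructor <;> linarith
  rcases lt_trichotomy j j' with h | rfl | h
  · exfalso
    have h3 : ((j : ℕ) : ℚ) + 1 ≤ ((j' : ℕ) : ℚ) := by
      have : (j : ℕ) + 1 ≤ (j' : ℕ) := h
      exact_mod_cast this
    linarith [hb.1]
  · exact hj'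
  · exfalso
    have h3 : ((j' : ℕ) : ℚ) + 1 ≤ ((j : ℕ) : ℚ) := by
      have : (j' : ℕ) + 1 ≤ (j : ℕ) := h
      exact_mod_cast this
    linarith [hb.2]

/-- the carrier -/
abbrev Car (six : Fin m → Bool) (f : Fin m → Cd) : Type := {x : ℚ // x ∉ Rem six f}

theorem Car_inst (f : Fin m → Cd) : DenselyOrdered (Car six f) ∧ NoMinOrder (Car six f) ∧
    NoMaxOrder (Car six f) ∧ Nonempty (Car six f) := by
  refine ⟨⟨?_⟩, ⟨?_⟩, ⟨?_⟩, ?_⟩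
  · rintro ⟨a, ha⟩ ⟨b, hb⟩ hab
    obtain ⟨c, hc, hc'⟩ := ((Set.Ioo_infinite (Subtype.mk_lt_mk.1 hab)).diff
      (Rem_finite (six := six) f)).nonempty
    exact ⟨⟨c, hc'⟩, hc.1, hc.2⟩
  · rintro ⟨a, ha⟩
    obtain ⟨c, hc, hc'⟩ := ((Set.Iio_infinite a).diff (Rem_finite (six := six) f)).nonempty
    exact ⟨⟨c, hc'⟩, hc⟩
  · rintro ⟨a, ha⟩
    obtain ⟨c, hc, hc'⟩ := ((Set.Ioi_infinite a).diff (Rem_finite (six := six) f)).nonempty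
    exact ⟨⟨c, hc'⟩, hc⟩
  · obtain ⟨c, hc, hc'⟩ := ((Set.Ioi_infinite (0 : ℚ)).diff (Rem_finite (six := six) f)).nonempty
    exact ⟨⟨c, hc'⟩⟩

theorem gq_notMem (f : Fin m → Cd) (i : Ix m) :
    gq six (wd f) i ∉ Rem six f := by
  obtain ⟨j, n, b⟩ := i
  have hb := gq_bd (six := six) (wd_bd f) j n b
  rw [Rem_blk f j hb.1 hb.2]
  have h1 := inv_bd n
  have h2 := wd_bd f j
  rintro (⟨h, h3, h4⟩ | ⟨h, h3, h4⟩)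
  · cases b
    · simp only [gq] at h
      linarith
    · simp only [gq] at h
      by_cases hs : six j = true
      · rw [if_pos hs] at h
        linarith
      · have ht := h4.resolve_left hs
        rw [if_neg hs, wd, if_pos ht] at h
        linarith
  · cases b
    · simp only [gq] at h
      linarith
    · simp only [gq, if_pos h4] at h
      linarith

theorem realize_code (f : Fin m → Cd) (hf : ∀ j, f j ∈ allowed (six j)) :
    ∃ (_ : (Lg (Ix m)).Structure (Car six f)), IsMod (g0 six) (Car six f) ∧
      ∀ j : Fin m, code (cut (Car six f) (cutSet j)) = f j := by
  classical
  obtain ⟨_, _, _, _⟩ := Car_inst (six := six) f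
  let c : Ix m → Car six f := fun i => ⟨gq six (wd f) i, gq_notMem f i⟩
  refine ⟨mkStr c, isMod_mkStr _ c (fun i j h => gq_lt one_bd (wd_bd f) i j h)
    (fun i j h => Subtype.ext (gq_eq one_bd (wd_bd f) i j h)), ?_⟩
  let _ := mkStr c
  intro j
  have hcut : ∀ x : Car six f, x ∈ cut (Car six f) (cutSet j) ↔
      10 * ((j : ℕ) : ℚ) ≤ x.1 ∧ x.1 ≤ 10 * ((j : ℕ) : ℚ) + wd f j ∧
      (six j = false → x.1 < 10 * ((j : ℕ) : ℚ) + wd f j) := by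
    intro x
    constructor
    · rintro ⟨h1, h2⟩
      have h1' : ∀ n : ℕ, 10 * ((j : ℕ) : ℚ) - 1 / ((n : ℚ) + 1) < x.1 :=
        fun n => h1 (j, n, false) (Or.inr ⟨rfl, rfl⟩)
      have h2' : ∀ n : ℕ, x.1 < 10 * ((j : ℕ) : ℚ) + wd f j +
          (if six j = true then 1 / ((n : ℚ) + 1) else 0) :=
        fun n => h2 (j, n, true) (by
          rintro (h | ⟨_, h⟩)
          · exact lt_irrefl _ h
          · simp at h)
      refine ⟨?_, ?_, ?_⟩
      · by_contra hc
        obtain ⟨n, hn⟩ := exists_nat_one_div_lt (sub_pos.2 (not_le.1 hc))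
        linarith [h1' n]
      · by_contra hc
        obtain ⟨n, hn⟩ := exists_nat_one_div_lt (sub_pos.2 (not_le.1 hc))
        have := h2' n
        have h3 := inv_bd n
        split_ifs at this <;> linarith
      · intro hs
        have := h2' 0
        rw [hs] at this
        simpa using this
    · rintro ⟨h1, h2, h3⟩
      refine ⟨?_, ?_⟩
      · rintro ⟨j', n, b⟩ hi
        show gq six (wd f) (j', n, b) < x.1
        refine lt_of_lt_of_le ?_ h1
        rcases hi with h | ⟨h, h'⟩
        · have hb := gq_bd (six := six) (wd_bd f) j' n b
          have h3 : ((j' : ℕ) : ℚ) + 1 ≤ ((j : ℕ) : ℚ) := by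
            have : (j' : ℕ) + 1 ≤ (j : ℕ) := h
            exact_mod_cast this
          linarith [hb.2]
        · simp only at h h'
          subst h h'
          have := inv_bd n
          simp only [gq]
          linarith
      · rintro ⟨j', n, b⟩ hi
        show x.1 < gq six (wd f) (j', n, b)
        rcases lt_trichotomy j' j with h | rfl | h
        · exact absurd (Or.inl h) hi
        · cases b
          · exact absurd (Or.inr ⟨rfl, rfl⟩) hi
          · have := inv_bd n
            simp only [gq]
            split_ifs with hs
            · linarith
            · have := h3 (by simpa using hs)
              linarith
        · have hb := gq_bd (six := six) (wd_bd f) j' n b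
          have h4 := wd_bd f j
          have h3 : ((j : ℕ) : ℚ) + 1 ≤ ((j' : ℕ) : ℚ) := by
            have : (j : ℕ) + 1 ≤ (j' : ℕ) := h
            exact_mod_cast this
          linarith [hb.1]
  have hR : ∀ x : ℚ, 10 * ((j : ℕ) : ℚ) ≤ x → x ≤ 10 * ((j : ℕ) : ℚ) + 1 →
      (x ∈ Rem six f ↔ rem1 six f j x) :=
    fun x h1 h2 => Rem_blk f j (by linarith) (by linarith)
  have ha := hf j
  have hwd : wd f j = if (f j).2.1 = true then 1 else 0 := rfl
  unfold rem1 at hR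
  generalize cut (Car six f) (cutSet j) = C at hcut
  generalize 10 * ((j : ℕ) : ℚ) = l at hcut hR
  rw [hwd] at hcut hR
  clear hwd
  generalize hc : f j = cc at *
  generalize six j = sx at *
  clear_value c
  obtain ⟨n, t, b, u⟩ := cc
  unfold allowed at ha
  rw [Finset.mem_filter] at ha
  replace ha := ha.2
  simp only at ha hcut hR
  unfold code
  cases t
  · simp only [Bool.false_eq_true, if_false, add_zero] at hcut hR ha
    cases sx
    · -- empty
      simp only [Bool.false_eq_true, if_false, forall_true_left] at hcut ha
      obtain ⟨rfl, rfl, h3⟩ := ha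
      have hb : b = false := by simpa using h3
      subst hb
      have hC : C = ∅ := by
        rw [Set.eq_empty_iff_forall_notMem]
        intro x hx
        have := (hcut x).1 hx
        linarith [this.1, this.2.2]
      subst hC
      simp [IsLeast, IsGreatest]
    · simp only [if_true] at ha
      obtain ⟨rfl, rfl⟩ := ha.2 trivial
      have hss : C.Subsingleton := by
        intro x hx y hy
        have h1 := (hcut x).1 hx
        have h2 := (hcut y).1 hy
        exact Subtype.ext (by linarith [h1.1, h1.2.1, h2.1, h2.2.1])
      have hnt : ¬ C.Nontrivial := Set.not_nontrivial_iff.2 hss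
      have hl := hR l le_rfl (by linarith)
      cases u
      · have hl' : l ∈ Rem six f := hl.2 (by simp)
        have hC : C = ∅ := by
          rw [Set.eq_empty_iff_forall_notMem]
          intro x hx
          have := (hcut x).1 hx
          have hxl : x.1 = l := by linarith [this.1, this.2.1]
          exact x.2 (hxl ▸ hl')
        subst hC
        simp [IsLeast, IsGreatest]
      · have hl' : l ∉ Rem six f := by rw [hl]; simp
        have hm : (⟨l, hl'⟩ : Car six f) ∈ C := (hcut _).2 (by simp)
        have h1 : C.Nonempty := ⟨_, hm⟩
        have h2 : ∃ x, IsLeast C x := ⟨_, hm, fun y hy => (hss hm hy).le⟩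
        have h3 : ∃ x, IsGreatest C x := ⟨_, hm, fun y hy => (hss hm hy).ge⟩
        simp [h1, h2, h3, hnt]
  · simp only [if_true] at hcut hR ha
    have hn : n = true := by
      cases sx
      · simp at ha; exact ha.1
      · simp at ha; exact ha
    subst hn
    have hin : ∀ x : ℚ, l < x → x < l + 1 → ∃ h : x ∉ Rem six f, (⟨x, h⟩ : Car six f) ∈ C := by
      intro x h1 h2
      have h3 : x ∉ Rem six f := by
        rw [hR x h1.le h2.le]
        rintro (⟨h, _⟩ | ⟨h, _⟩) <;> linarith
      exact ⟨h3, (hcut _).2 ⟨h1.le, h2.le, fun _ => h2⟩⟩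
    have hnt : C.Nontrivial := by
      obtain ⟨h1, h1'⟩ := hin (l + 1 / 3) (by linarith) (by linarith)
      obtain ⟨h2, h2'⟩ := hin (l + 2 / 3) (by linarith) (by linarith)
      refine ⟨_, h1', _, h2', ?_⟩
      intro h
      have := congrArg Subtype.val h
      simp only at this
      linarith
    have hne := hnt.nonempty
    have hleast : (∃ x, IsLeast C x) ↔ b = true := by
      have hl := hR l le_rfl (by linarith)
      constructor
      · rintro ⟨x, hx, hm⟩
        by_contra hb
        have hb : b = false := by simpa using hb
        have hl' : l ∈ Rem six f := hl.2 (Or.inl ⟨rfl, hb, Or.inr trivial⟩)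
        have h1 := (hcut x).1 hx
        have hxl : l < x.1 := lt_of_le_of_ne h1.1 (fun h => x.2 (h ▸ hl'))
        obtain ⟨h2, h2'⟩ := hin ((l + x.1) / 2) (by linarith) (by linarith [h1.2.1])
        have h3 : x.1 ≤ (l + x.1) / 2 := hm h2'
        linarith
      · rintro rfl
        have hl' : l ∉ Rem six f := by rw [hl]; simp
        exact ⟨⟨l, hl'⟩, (hcut _).2 ⟨le_rfl, by simp, fun _ => by simp⟩, fun y hy => ((hcut y).1 hy).1⟩
    have hgreat : (∃ x, IsGreatest C x) ↔ u = true := by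
      have hl := hR (l + 1) (by linarith) le_rfl
      constructor
      · rintro ⟨x, hx, hm⟩
        by_contra hb
        have hb : u = false := by simpa using hb
        have h1 := (hcut x).1 hx
        have hxl : x.1 < l + 1 := by
          cases sx
          · exact h1.2.2 rfl
          · have hl' : l + 1 ∈ Rem six f := hl.2 (Or.inr ⟨rfl, hb, rfl⟩)
            exact lt_of_le_of_ne h1.2.1 (fun h => x.2 (h ▸ hl'))
        obtain ⟨h2, h2'⟩ := hin ((l + 1 + x.1) / 2) (by linarith [h1.1]) (by linarith)
        have h3 : (l + 1 + x.1) / 2 ≤ x.1 := hm h2'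
        linarith
      · rintro rfl
        have hs : sx = true := by
          cases sx
          · simp at ha
          · rfl
        have hl' : l + 1 ∉ Rem six f := by rw [hl]; simp
        exact ⟨⟨l + 1, hl'⟩, (hcut _).2 ⟨by simp, le_rfl, fun h => by simp [hs] at h⟩,
          fun y hy => ((hcut y).1 hy).2.1⟩
    simp [hne, hnt, hleast, hgreat]

end Realize

theorem count (six : Fin m → Bool) :
    IOmega (Th (g0 six)) = ((∏ j, (if six j = true then 6 else 3) : ℕ) : Cardinal) := by
  classical
  have hord : ∀ X : CtbleModel (Th (g0 six)), ∃ o : LinearOrder X.1.Carrier,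
      IsMod (g0 six) X.1.Carrier := fun X => exists_order X.1.is_model
  choose o ho using hord
  let inv : CtbleModel (Th (g0 six)) → ∀ j : Fin m, allowed (six j) := fun X j =>
    ⟨@code _ (o X) (@cut _ X.1.Carrier _ (o X) (cutSet j)), @code_mem _ _ _ _ (o X) (ho X) j⟩
  have hinv : ∀ X Y, (isoSetoid (Th (g0 six))).r X Y ↔ inv X = inv Y := by
    intro X Y
    let _ := o X
    let _ := o Y
    have := X.2
    have := Y.2
    constructor
    · rintro ⟨e⟩
      funext j
      exact Subtype.ext ((code_eq_iff _ _).2 (iso_same (ho X) (ho Y) e _))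
    · intro h
      refine mod_iso (ho X) (ho Y) (all_same (ho X) (ho Y) (fun j => ?_))
      exact (code_eq_iff _ _).1 (congrArg Subtype.val (congrFun h j))
  let F : Quotient (isoSetoid (Th (g0 six))) → ∀ j : Fin m, allowed (six j) :=
    Quotient.lift inv (fun X Y h => (hinv X Y).1 h)
  have hF : Function.Bijective F := by
    constructor
    · intro a b
      induction a using Quotient.inductionOn
      induction b using Quotient.inductionOn
      intro h
      exact Quotient.sound ((hinv _ _).2 h)
    · intro f
      obtain ⟨S, hS, hc⟩ := realize_code (six := six) (fun j => (f j).1) (fun j => (f j).2)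
      have hmod := isMod_model hS
      have := hS.ne
      let X : CtbleModel (Th (g0 six)) := ⟨⟨Car six (fun j => (f j).1)⟩, inferInstance⟩
      refine ⟨Quotient.mk _ X, ?_⟩
      change inv X = f
      funext j
      apply Subtype.ext
      rw [← hc j]
      let e : X.1.Carrier ≃[Lg (Ix m)] Car six (fun j => (f j).1) := Language.Equiv.refl _ _
      exact (@code_eq_iff _ _ (o X) _ _ _).2 (@iso_same _ _ _ _ _ (o X) _ _ (ho X) hS e _)
  unfold IOmega
  rw [Cardinal.mk_eq_nat_iff]
  have hcard : Fintype.card (∀ j : Fin m, allowed (six j)) =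
      ∏ j, (if six j = true then 6 else 3) := by
    rw [Fintype.card_pi]
    exact Finset.prod_congr rfl (fun j _ => by rw [Fintype.card_coe, allowed_card])
  exact ⟨(Equiv.ofBijective F hF).trans (Fintype.equivFinOfCardEq hcard)⟩

end Count

/-- For all naturals `k, s` there is an o-minimal complete theory in a countable language
with exactly `3^k · 6^s` countable models. -/
theorem exists_ominimal_with_models (k s : ℕ) :
    ∃ (L : FirstOrder.Language.{0, 0}) (lt : L.Relations 2) (T : L.Theory),
      Countable L.Symbols ∧ T.IsComplete ∧ OMinimalTheory lt T ∧
      IOmega T = ((3 ^ k * 6 ^ s : ℕ) : Cardinal) := by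
  let six : Fin (k + s) → Bool := fun j => decide (k ≤ (j : ℕ))
  refine ⟨Lg (Ix (k + s)), ltS _, Th (g0 six), Lg_countable, Th_complete _,
    fun M _ hM => omin _ M hM, ?_⟩
  rw [count]
  congr 1
  rw [Fin.prod_univ_add]
  have hx : ∀ x : Fin k, ¬ k ≤ (x:ℕ) := fun x => not_le.2 x.2; simp [six, hx]

end QOM
end

section
/- Let T₁ and T₂ be small complete first-order theories with infinite models in disjoint countable relational languages Σ₁ and Σ₂. Then the number of pairwise non-isomorphic countable models of the disjoint union theory T₁ ⊔ T₂ equals the product of the numbers of pairwise non-isomorphic countable models of T₁ and of T₂: I(T₁ ⊔ T₂, ω) = I(T₁, ω) · I(T₂, ω). -/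
open FirstOrder FirstOrder.Language Cardinal

universe u v w

namespace QOM

variable {L : FirstOrder.Language.{u, v}}

/-- The language of the disjoint union: the relation symbols of `Σ₁` and of `Σ₂`, together
with two new unary predicate symbols `P₁` (coded `true`) and `P₂` (coded `false`). -/
def duLang (L₁ L₂ : FirstOrder.Language.{u, v}) : FirstOrder.Language.{u, v} where
  Functions := fun _ => PEmpty
  Relations := fun n => (L₁.Relations n ⊕ L₂.Relations n) ⊕ ULift (Bool × PLift (n = 1))

/-- The disjoint union of two structures: `Pᵢ` is interpreted as the universe of `Mᵢ` and
each `Σᵢ`-relation symbol as in `Mᵢ`, holding only on tuples from `Pᵢ`. -/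
instance duStructure (L₁ L₂ : FirstOrder.Language.{u, v}) (M₁ M₂ : Type w)
    [L₁.Structure M₁] [L₂.Structure M₂] : (duLang L₁ L₂).Structure (M₁ ⊕ M₂) where
  funMap {n} f _ := (show PEmpty from f).elim
  RelMap {n} r v :=
    match show (L₁.Relations n ⊕ L₂.Relations n) ⊕ ULift (Bool × PLift (n = 1)) from r with
    | Sum.inl (Sum.inl r₁) => ∃ t : Fin n → M₁, v = Sum.inl ∘ t ∧ Structure.RelMap r₁ t
    | Sum.inl (Sum.inr r₂) => ∃ t : Fin n → M₂, v = Sum.inr ∘ t ∧ Structure.RelMap r₂ t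
    | Sum.inr ⟨(b, h)⟩ =>
        if b then (v (Fin.cast h.down.symm 0)).isLeft = true
        else (v (Fin.cast h.down.symm 0)).isRight = true

section aux

universe w'

variable {L₁ L₂ : FirstOrder.Language.{u, v}}

instance duRel : (duLang L₁ L₂).IsRelational := fun _ => inferInstanceAs (IsEmpty PEmpty)

/-- Index of the variable that a term of a relational language is. -/
def termVar {L : FirstOrder.Language.{u, v}} [L.IsRelational] {n : ℕ} :
    L.Term (Empty ⊕ Fin n) → Fin n
  | Term.var (Sum.inr i) => i
  | Term.var (Sum.inl e) => e.elim
  | Term.func f _ => isEmptyElim f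

theorem realize_termVar {L : FirstOrder.Language.{u, v}} [L.IsRelational] {n : ℕ}
    {M : Type w} [L.Structure M] (e : Empty → M) (v : Fin n → M) (t : L.Term (Empty ⊕ Fin n)) :
    t.realize (Sum.elim e v) = v (termVar t) := by
  match t with
  | Term.var (Sum.inr i) => rfl
  | Term.var (Sum.inl e) => exact e.elim
  | Term.func f _ => exact isEmptyElim f

/-- Relation symbols of the union language. -/
def rl {n : ℕ} (r : L₁.Relations n) : (duLang L₁ L₂).Relations n := Sum.inl (Sum.inl r)
def rr {n : ℕ} (r : L₂.Relations n) : (duLang L₁ L₂).Relations n := Sum.inl (Sum.inr r)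
def pp (L₁ L₂ : FirstOrder.Language.{u, v}) (b : Bool) : (duLang L₁ L₂).Relations 1 :=
  Sum.inr ⟨(b, ⟨rfl⟩)⟩

section
variable {M₁ M₂ : Type w} [L₁.Structure M₁] [L₂.Structure M₂]

theorem relMap_rl {n : ℕ} (r : L₁.Relations n) (v : Fin n → M₁ ⊕ M₂) :
    Structure.RelMap (rl (L₂ := L₂) r) v ↔
      ∃ t : Fin n → M₁, v = Sum.inl ∘ t ∧ Structure.RelMap r t := Iff.rfl

theorem relMap_rr {n : ℕ} (r : L₂.Relations n) (v : Fin n → M₁ ⊕ M₂) :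
    Structure.RelMap (rr (L₁ := L₁) r) v ↔
      ∃ t : Fin n → M₂, v = Sum.inr ∘ t ∧ Structure.RelMap r t := Iff.rfl

theorem relMap_pt (v : Fin 1 → M₁ ⊕ M₂) :
    Structure.RelMap (pp L₁ L₂ true) v ↔ (v 0).isLeft = true := by
  change (if true then (v (Fin.cast _ 0)).isLeft = true else _) ↔ _
  simp

theorem relMap_pf (v : Fin 1 → M₁ ⊕ M₂) :
    Structure.RelMap (pp L₁ L₂ false) v ↔ (v 0).isRight = true := by
  change (if false then _ else (v (Fin.cast _ 0)).isRight = true) ↔ _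
  simp
end

theorem rel_cases {n : ℕ} (r : (duLang L₁ L₂).Relations n) :
    (∃ r₁, r = rl r₁) ∨ (∃ r₂, r = rr r₂) ∨
      ∃ (h : 1 = n) (b : Bool), r = h ▸ pp L₁ L₂ b := by
  rcases r with (r | r) | ⟨b, ⟨h⟩⟩
  · exact Or.inl ⟨r, rfl⟩
  · exact Or.inr (Or.inl ⟨r, rfl⟩)
  · subst h
    exact Or.inr (Or.inr ⟨rfl, b, rfl⟩)

/-! ### Feferman-Vaught -/

/-- Finite unions of rectangles. -/
abbrev RL (L₁ L₂ : FirstOrder.Language.{u, v}) (k l : ℕ) :=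
  List (L₁.BoundedFormula Empty k × L₂.BoundedFormula Empty l)

def RL.Holds {k l : ℕ} (R : RL L₁ L₂ k l) (M₁ M₂ : Type w) [L₁.Structure M₁] [L₂.Structure M₂]
    (x : Fin k → M₁) (y : Fin l → M₂) : Prop :=
  ∃ p ∈ R, p.1.Realize Empty.elim x ∧ p.2.Realize Empty.elim y

def RL.inter {k l : ℕ} (R S : RL L₁ L₂ k l) : RL L₁ L₂ k l :=
  R.flatMap fun p => S.map fun q => (p.1 ⊓ q.1, p.2 ⊓ q.2)

def RL.compl {k l : ℕ} : RL L₁ L₂ k l → RL L₁ L₂ k l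
  | [] => [(⊤, ⊤)]
  | p :: R => RL.inter [(∼p.1, ⊤), (⊤, ∼p.2)] (RL.compl R)

def RL.exL {k l : ℕ} (R : RL L₁ L₂ (k + 1) l) : RL L₁ L₂ k l :=
  R.map fun p => (∃' p.1, p.2)

def RL.exR {k l : ℕ} (R : RL L₁ L₂ k (l + 1)) : RL L₁ L₂ k l :=
  R.map fun p => (p.1, ∃' p.2)

section
variable {M₁ M₂ : Type w} [L₁.Structure M₁] [L₂.Structure M₂] {k l : ℕ}

theorem RL.holds_append (R S : RL L₁ L₂ k l) (x : Fin k → M₁) (y : Fin l → M₂) :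
    RL.Holds (R ++ S) M₁ M₂ x y ↔ R.Holds M₁ M₂ x y ∨ S.Holds M₁ M₂ x y := by
  simp only [RL.Holds, List.mem_append, or_and_right, exists_or]

theorem RL.holds_inter (R S : RL L₁ L₂ k l) (x : Fin k → M₁) (y : Fin l → M₂) :
    (R.inter S).Holds M₁ M₂ x y ↔ R.Holds M₁ M₂ x y ∧ S.Holds M₁ M₂ x y := by
  simp only [RL.Holds, RL.inter, List.mem_flatMap, List.mem_map]
  constructor
  · rintro ⟨_, ⟨p, hp, q, hq, rfl⟩, h1, h2⟩
    rw [BoundedFormula.realize_inf] at h1 h2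
    exact ⟨⟨p, hp, h1.1, h2.1⟩, ⟨q, hq, h1.2, h2.2⟩⟩
  · rintro ⟨⟨p, hp, h1, h2⟩, ⟨q, hq, h3, h4⟩⟩
    refine ⟨_, ⟨p, hp, q, hq, rfl⟩, ?_, ?_⟩
    · exact BoundedFormula.realize_inf.2 ⟨h1, h3⟩
    · exact BoundedFormula.realize_inf.2 ⟨h2, h4⟩

theorem RL.holds_compl (R : RL L₁ L₂ k l) (x : Fin k → M₁) (y : Fin l → M₂) :
    R.compl.Holds M₁ M₂ x y ↔ ¬ R.Holds M₁ M₂ x y := by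
  induction R with
  | nil => simp [RL.compl, RL.Holds]
  | cons p R ih =>
    rw [RL.compl, RL.holds_inter, ih]
    simp only [RL.Holds, List.mem_cons, List.not_mem_nil, or_false, exists_eq_or_imp,
      exists_eq_left, BoundedFormula.realize_not, BoundedFormula.realize_top, and_true, true_and,
      not_or, not_and_or]

theorem RL.holds_exL (R : RL L₁ L₂ (k + 1) l) (x : Fin k → M₁) (y : Fin l → M₂) :
    R.exL.Holds M₁ M₂ x y ↔ ∃ a, R.Holds M₁ M₂ (Fin.snoc x a) y := by
  simp only [RL.Holds, RL.exL, List.mem_map]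
  constructor
  · rintro ⟨_, ⟨p, hp, rfl⟩, h1, h2⟩
    obtain ⟨a, ha⟩ := BoundedFormula.realize_ex.1 h1
    exact ⟨a, p, hp, ha, h2⟩
  · rintro ⟨a, p, hp, ha, h2⟩
    exact ⟨_, ⟨p, hp, rfl⟩, BoundedFormula.realize_ex.2 ⟨a, ha⟩, h2⟩

theorem RL.holds_exR (R : RL L₁ L₂ k (l + 1)) (x : Fin k → M₁) (y : Fin l → M₂) :
    R.exR.Holds M₁ M₂ x y ↔ ∃ a, R.Holds M₁ M₂ x (Fin.snoc y a) := by
  simp only [RL.Holds, RL.exR, List.mem_map]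
  constructor
  · rintro ⟨_, ⟨p, hp, rfl⟩, h1, h2⟩
    obtain ⟨a, ha⟩ := BoundedFormula.realize_ex.1 h2
    exact ⟨a, p, hp, h1, ha⟩
  · rintro ⟨a, p, hp, ha, h2⟩
    exact ⟨_, ⟨p, hp, rfl⟩, ha, BoundedFormula.realize_ex.2 ⟨a, h2⟩⟩
end

open Classical in
/-- Translation of an atomic equality. -/
noncomputable def eqTr {k l : ℕ} (a b : Fin k ⊕ Fin l) : RL L₁ L₂ k l :=
  match a, b with
  | Sum.inl i, Sum.inl j =>
      [(BoundedFormula.equal (Term.var (Sum.inr i)) (Term.var (Sum.inr j)), ⊤)]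
  | Sum.inr i, Sum.inr j =>
      [(⊤, BoundedFormula.equal (Term.var (Sum.inr i)) (Term.var (Sum.inr j)))]
  | _, _ => []

open Classical in
/-- Translation of an atomic relation. -/
noncomputable def relTr {n k l : ℕ} (r : (duLang L₁ L₂).Relations n) (a : Fin n → Fin k ⊕ Fin l) :
    RL L₁ L₂ k l :=
  match r with
  | Sum.inl (Sum.inl r₁) =>
      if h : ∃ t : Fin n → Fin k, a = Sum.inl ∘ t then
        [(BoundedFormula.rel r₁ fun i => Term.var (Sum.inr (h.choose i)), ⊤)] else []
  | Sum.inl (Sum.inr r₂) =>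
      if h : ∃ t : Fin n → Fin l, a = Sum.inr ∘ t then
        [(⊤, BoundedFormula.rel r₂ fun i => Term.var (Sum.inr (h.choose i)))] else []
  | Sum.inr ⟨(b, h)⟩ =>
      if (if b then (a (Fin.cast h.down.symm 0)).isLeft = true
        else (a (Fin.cast h.down.symm 0)).isRight = true) then [(⊤, ⊤)] else []

/-- Extension of the variable assignment by a left variable. -/
def extL {n k l : ℕ} (σ : Fin n → Fin k ⊕ Fin l) : Fin (n + 1) → Fin (k + 1) ⊕ Fin l :=
  Fin.snoc (α := fun _ => Fin (k + 1) ⊕ Fin l) (Sum.map Fin.castSucc id ∘ σ)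
    (Sum.inl (Fin.last k))

/-- Extension of the variable assignment by a right variable. -/
def extR {n k l : ℕ} (σ : Fin n → Fin k ⊕ Fin l) : Fin (n + 1) → Fin k ⊕ Fin (l + 1) :=
  Fin.snoc (α := fun _ => Fin k ⊕ Fin (l + 1)) (Sum.map id Fin.castSucc ∘ σ)
    (Sum.inr (Fin.last l))

/-- The Feferman-Vaught translation. -/
noncomputable def fv : {n : ℕ} → (duLang L₁ L₂).BoundedFormula Empty n →
    (k l : ℕ) → (Fin n → Fin k ⊕ Fin l) → RL L₁ L₂ k l
  | _, .falsum, _, _, _ => []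
  | _, .equal s t, _, _, σ => eqTr (σ (termVar s)) (σ (termVar t))
  | _, .rel r ts, _, _, σ => relTr r fun i => σ (termVar (ts i))
  | _, .imp f g, k, l, σ => RL.compl (fv f k l σ) ++ fv g k l σ
  | _, .all f, k, l, σ =>
      RL.compl (RL.exL (RL.compl (fv f (k + 1) l (extL σ))) ++
        RL.exR (RL.compl (fv f k (l + 1) (extR σ))))

section
variable {M₁ M₂ : Type w} [L₁.Structure M₁] [L₂.Structure M₂]

theorem holds_eqTr {k l : ℕ} (a b : Fin k ⊕ Fin l) (x : Fin k → M₁) (y : Fin l → M₂) :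
    (eqTr (L₁ := L₁) (L₂ := L₂) a b).Holds M₁ M₂ x y ↔ Sum.map x y a = Sum.map x y b := by
  rcases a with a | a <;> rcases b with b | b <;>
    simp [eqTr, RL.Holds, BoundedFormula.Realize]

theorem holds_relTr {n k l : ℕ} (r : (duLang L₁ L₂).Relations n) (a : Fin n → Fin k ⊕ Fin l)
    (x : Fin k → M₁) (y : Fin l → M₂) :
    (relTr r a).Holds M₁ M₂ x y ↔ Structure.RelMap r (Sum.map x y ∘ a) := by
  rcases r with (r | r) | ⟨b, ⟨h⟩⟩
  · change _ ↔ ∃ t : Fin n → M₁, Sum.map x y ∘ a = Sum.inl ∘ t ∧ Structure.RelMap r t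
    by_cases h : ∃ t : Fin n → Fin k, a = Sum.inl ∘ t
    · have e := h.choose_spec
      simp only [relTr, dif_pos h]
      generalize h.choose = t at *
      subst e
      simp only [RL.Holds, List.mem_singleton, exists_eq_left, BoundedFormula.realize_top,
        and_true]
      constructor
      · intro h'
        exact ⟨x ∘ t, rfl, h'⟩
      · rintro ⟨t', h1, h2⟩
        have : t' = x ∘ t := by
          funext i
          have := congrFun h1 i
          simpa using this.symm
        subst this
        exact h2
    · simp only [relTr, dif_neg h]
      constructor
      · rintro ⟨_, h', _⟩
        simp at h'
      · rintro ⟨t', h1, h2⟩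
        exfalso
        apply h
        have : ∀ i, ∃ j, a i = Sum.inl j := by
          intro i
          have := congrFun h1 i
          rcases hai : a i with j | j
          · exact ⟨j, rfl⟩
          · simp [hai] at this
        choose t ht using this
        exact ⟨t, funext ht⟩
  · change _ ↔ ∃ t : Fin n → M₂, Sum.map x y ∘ a = Sum.inr ∘ t ∧ Structure.RelMap r t
    by_cases h : ∃ t : Fin n → Fin l, a = Sum.inr ∘ t
    · have e := h.choose_spec
      simp only [relTr, dif_pos h]
      generalize h.choose = t at *
      subst e
      simp only [RL.Holds, List.mem_singleton, exists_eq_left, BoundedFormula.realize_top,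
        true_and]
      constructor
      · intro h'
        exact ⟨y ∘ t, rfl, h'⟩
      · rintro ⟨t', h1, h2⟩
        have : t' = y ∘ t := by
          funext i
          have := congrFun h1 i
          simpa using this.symm
        subst this
        exact h2
    · simp only [relTr, dif_neg h]
      constructor
      · rintro ⟨_, h', _⟩
        simp at h'
      · rintro ⟨t', h1, h2⟩
        exfalso
        apply h
        have : ∀ i, ∃ j, a i = Sum.inr j := by
          intro i
          have := congrFun h1 i
          rcases hai : a i with j | j
          · simp [hai] at this
          · exact ⟨j, rfl⟩
        choose t ht using this
        exact ⟨t, funext ht⟩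
  · subst h
    cases b
    · refine Iff.trans ?_ (relMap_pf _).symm
      rcases h0 : a 0 with j | j <;> simp [relTr, RL.Holds, h0]
    · refine Iff.trans ?_ (relMap_pt _).symm
      rcases h0 : a 0 with j | j <;> simp [relTr, RL.Holds, h0]

theorem extL_comp {n k l : ℕ} (σ : Fin n → Fin k ⊕ Fin l) (x : Fin k → M₁) (y : Fin l → M₂)
    (a : M₁) : Sum.map (Fin.snoc x a) y ∘ extL σ =
      Fin.snoc (α := fun _ => M₁ ⊕ M₂) (Sum.map x y ∘ σ) (Sum.inl a) := by
  funext i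
  refine Fin.lastCases ?_ (fun i => ?_) i
  · simp [extL]
  · simp only [extL, Function.comp_apply, Fin.snoc_castSucc]
    rcases σ i with j | j <;> simp

theorem extR_comp {n k l : ℕ} (σ : Fin n → Fin k ⊕ Fin l) (x : Fin k → M₁) (y : Fin l → M₂)
    (a : M₂) : Sum.map x (Fin.snoc y a) ∘ extR σ =
      Fin.snoc (α := fun _ => M₁ ⊕ M₂) (Sum.map x y ∘ σ) (Sum.inr a) := by
  funext i
  refine Fin.lastCases ?_ (fun i => ?_) i
  · simp [extR]
  · simp only [extR, Function.comp_apply, Fin.snoc_castSucc]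
    rcases σ i with j | j <;> simp

theorem holds_fv {n : ℕ} (φ : (duLang L₁ L₂).BoundedFormula Empty n) :
    ∀ (k l : ℕ) (σ : Fin n → Fin k ⊕ Fin l) (x : Fin k → M₁) (y : Fin l → M₂),
    (fv φ k l σ).Holds M₁ M₂ x y ↔ φ.Realize Empty.elim (Sum.map x y ∘ σ) := by
  induction φ with
  | falsum => intro k l σ x y; simp [fv, RL.Holds, BoundedFormula.Realize]
  | equal s t =>
    intro k l σ x y
    rw [fv, holds_eqTr, BoundedFormula.Realize, realize_termVar, realize_termVar]
    rfl
  | rel r ts =>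
    intro k l σ x y
    rw [fv, holds_relTr, BoundedFormula.Realize]
    simp only [realize_termVar]
    rfl
  | imp f g ihf ihg =>
    intro k l σ x y
    rw [fv, RL.holds_append, RL.holds_compl, ihf, ihg, BoundedFormula.realize_imp]
    tauto
  | all f ih =>
    intro k l σ x y
    rw [fv, RL.holds_compl, RL.holds_append, RL.holds_exL, RL.holds_exR,
      BoundedFormula.realize_all]
    simp only [RL.holds_compl, ih, extL_comp, extR_comp, not_or, not_exists, not_not]
    exact (Sum.forall (p := fun a => f.Realize Empty.elim
      (Fin.snoc (α := fun _ => M₁ ⊕ M₂) (Sum.map x y ∘ σ) a))).symm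
end

theorem realize_du {M₁ M₂ : Type w} [L₁.Structure M₁] [L₂.Structure M₂]
    {N₁ N₂ : Type w'} [L₁.Structure N₁] [L₂.Structure N₂]
    (h₁ : ∀ φ : L₁.Sentence, M₁ ⊨ φ ↔ N₁ ⊨ φ) (h₂ : ∀ φ : L₂.Sentence, M₂ ⊨ φ ↔ N₂ ⊨ φ)
    (φ : (duLang L₁ L₂).Sentence) : (M₁ ⊕ M₂) ⊨ φ ↔ (N₁ ⊕ N₂) ⊨ φ := by
  have key : ∀ {L : FirstOrder.Language.{u, v}} {A : Type w'} [L.Structure A] (ψ : L.Sentence)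
      (e : Empty → A) (x : Fin 0 → A), A ⊨ ψ ↔ BoundedFormula.Realize ψ e x := by
    intro L A _ ψ e x
    rw [Sentence.Realize, Formula.Realize, Subsingleton.elim e default,
      Subsingleton.elim x default]
  have key' : ∀ {L : FirstOrder.Language.{u, v}} {A : Type w} [L.Structure A] (ψ : L.Sentence)
      (e : Empty → A) (x : Fin 0 → A), A ⊨ ψ ↔ BoundedFormula.Realize ψ e x := by
    intro L A _ ψ e x
    rw [Sentence.Realize, Formula.Realize, Subsingleton.elim e default,
      Subsingleton.elim x default]
  rw [key' φ Empty.elim (Sum.map Fin.elim0 Fin.elim0 ∘ Fin.elim0), ← holds_fv φ 0 0,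
    key φ Empty.elim (Sum.map Fin.elim0 Fin.elim0 ∘ Fin.elim0), ← holds_fv φ 0 0]
  simp only [RL.Holds]
  refine exists_congr fun p => and_congr_right fun _ => and_congr ?_ ?_
  · rw [← key', ← key]; exact h₁ _
  · rw [← key', ← key]; exact h₂ _

/-! ### Relativization -/

section relativize
variable {L L' : FirstOrder.Language.{u, v}} [L.IsRelational]

def toTerm {n : ℕ} (t : L.Term (Empty ⊕ Fin n)) : L'.Term (Empty ⊕ Fin n) :=
  Term.var (Sum.inr (termVar t))

/-- Relativization of formulas to a predicate. -/
def relz (f : ∀ {n : ℕ}, L.Relations n → L'.Relations n) (P : L'.Relations 1) :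
    {n : ℕ} → L.BoundedFormula Empty n → L'.BoundedFormula Empty n
  | _, .falsum => .falsum
  | _, .equal s t => .equal (toTerm s) (toTerm t)
  | _, .rel r ts => .rel (f r) fun i => toTerm (ts i)
  | _, .imp φ ψ => .imp (relz f P φ) (relz f P ψ)
  | n, .all φ => .all (.imp (.rel P fun _ => Term.var (Sum.inr (Fin.last n))) (relz f P φ))

theorem realize_relz (f : ∀ {n : ℕ}, L.Relations n → L'.Relations n) (P : L'.Relations 1)
    {N K : Type*} [L.Structure N] [L'.Structure K] (e : N → K) (he : Function.Injective e)
    (hP : ∀ x : K, Structure.RelMap P (fun _ => x) ↔ ∃ y, e y = x)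
    (hR : ∀ {n : ℕ} (r : L.Relations n) (v : Fin n → N),
      Structure.RelMap (f r) (e ∘ v) ↔ Structure.RelMap r v)
    {n : ℕ} (φ : L.BoundedFormula Empty n) : ∀ (v : Fin n → N),
    (relz f P φ).Realize Empty.elim (e ∘ v) ↔ φ.Realize Empty.elim v := by
  induction φ with
  | falsum => intro v; simp [relz, BoundedFormula.Realize]
  | equal s t =>
    intro v
    simp only [relz, BoundedFormula.Realize, realize_termVar, toTerm, Term.realize_var,
      Sum.elim_inr, Function.comp_apply]
    exact he.eq_iff
  | rel r ts =>
    intro v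
    simp only [relz, BoundedFormula.Realize, realize_termVar, toTerm, Term.realize_var,
      Sum.elim_inr, Function.comp_apply]
    exact hR r fun i => v (termVar (ts i))
  | imp f g ihf ihg =>
    intro v
    rw [relz, BoundedFormula.realize_imp, BoundedFormula.realize_imp, ihf, ihg]
  | @all n φ ih =>
    intro v
    rw [relz, BoundedFormula.realize_all, BoundedFormula.realize_all]
    have hs : ∀ y, Fin.snoc (α := fun _ => K) (e ∘ v) (e y) =
        e ∘ Fin.snoc (α := fun _ => N) v y := by
      intro y
      exact (Fin.comp_snoc e v y).symm
    constructor
    · intro h y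
      have := h (e y)
      rw [BoundedFormula.realize_imp, hs, ih] at this
      apply this
      simp only [BoundedFormula.Realize, Term.realize_var, Sum.elim_inr, Function.comp_apply,
        Fin.snoc_last]
      exact (hP _).2 ⟨y, rfl⟩
    · intro h x
      rw [BoundedFormula.realize_imp]
      intro hx
      simp only [BoundedFormula.Realize, Term.realize_var, Sum.elim_inr,
        Fin.snoc_last] at hx
      obtain ⟨y, rfl⟩ := (hP _).1 hx
      rw [hs, ih]
      exact h y

theorem realize_relz_sentence (f : ∀ {n : ℕ}, L.Relations n → L'.Relations n)
    (P : L'.Relations 1)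
    {N K : Type*} [L.Structure N] [L'.Structure K] (e : N → K) (he : Function.Injective e)
    (hP : ∀ x : K, Structure.RelMap P (fun _ => x) ↔ ∃ y, e y = x)
    (hR : ∀ {n : ℕ} (r : L.Relations n) (v : Fin n → N),
      Structure.RelMap (f r) (e ∘ v) ↔ Structure.RelMap r v)
    (φ : L.Sentence) : K ⊨ (relz f P φ : L'.Sentence) ↔ N ⊨ φ := by
  have := realize_relz f P e he hP hR φ default
  rw [Sentence.Realize, Formula.Realize, Sentence.Realize, Formula.Realize,
    Subsingleton.elim (default : Empty → N) Empty.elim,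
    Subsingleton.elim (default : Empty → K) Empty.elim, ← this,
    Subsingleton.elim (e ∘ default) default]

/-- Structure on a definable subset. -/
@[reducible] def subStr (f : ∀ {n : ℕ}, L.Relations n → L'.Relations n) (K : Type*) [L'.Structure K]
    (S : Set K) : L.Structure S where
  funMap g _ := isEmptyElim g
  RelMap r v := Structure.RelMap (f r) (Subtype.val ∘ v)

end relativize

/-! ### Isomorphisms -/

def sumEquiv {M₁ M₂ N₁ N₂ : Type w} [L₁.Structure M₁] [L₂.Structure M₂]
    [L₁.Structure N₁] [L₂.Structure N₂] (e₁ : M₁ ≃[L₁] N₁) (e₂ : M₂ ≃[L₂] N₂) :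
    (M₁ ⊕ M₂) ≃[duLang L₁ L₂] (N₁ ⊕ N₂) where
  toEquiv := Equiv.sumCongr e₁.toEquiv e₂.toEquiv
  map_fun' f := isEmptyElim f
  map_rel' := by
    intro n r x
    obtain ⟨r, rfl⟩ | ⟨r, rfl⟩ | ⟨rfl, b, rfl⟩ := rel_cases r
    · simp only [relMap_rl]
      constructor
      · rintro ⟨t, h1, h2⟩
        refine ⟨e₁.symm ∘ t, ?_, (e₁.symm.map_rel r t).2 h2⟩
        funext i
        have := congrFun h1 i
        rcases hx : x i with a | a
        · simp [hx] at this
          simp only [Function.comp_apply, ← this]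
          exact congrArg Sum.inl (e₁.symm_apply_apply a).symm
        · simp [hx] at this
      · rintro ⟨t, rfl, h2⟩
        exact ⟨e₁ ∘ t, rfl, (e₁.map_rel r t).2 h2⟩
    · simp only [relMap_rr]
      constructor
      · rintro ⟨t, h1, h2⟩
        refine ⟨e₂.symm ∘ t, ?_, (e₂.symm.map_rel r t).2 h2⟩
        funext i
        have := congrFun h1 i
        rcases hx : x i with a | a
        · simp [hx] at this
        · simp [hx] at this
          simp only [Function.comp_apply, ← this]
          exact congrArg Sum.inr (e₂.symm_apply_apply a).symm
      · rintro ⟨t, rfl, h2⟩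
        exact ⟨e₂ ∘ t, rfl, (e₂.map_rel r t).2 h2⟩
    · cases b
      · simp only [relMap_pf]
        rcases hx : x 0 with a | a <;> simp [hx]
      · simp only [relMap_pt]
        rcases hx : x 0 with a | a <;> simp [hx]

theorem equiv_left {M₁ M₂ N₁ N₂ : Type w} [L₁.IsRelational] [L₁.Structure M₁] [L₂.Structure M₂]
    [L₁.Structure N₁] [L₂.Structure N₂] (e : (M₁ ⊕ M₂) ≃[duLang L₁ L₂] (N₁ ⊕ N₂)) :
    Nonempty (M₁ ≃[L₁] N₁) := by
  have h1 : ∀ x, (e x).isLeft = true ↔ x.isLeft = true := by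
    intro x
    have := e.map_rel (pp L₁ L₂ true) (fun _ => x)
    rwa [relMap_pt, relMap_pt] at this
  have hf : ∀ a : M₁, ∃ b : N₁, e (Sum.inl a) = Sum.inl b := fun a => by
    have := (h1 (Sum.inl a)).2 rfl
    exact Sum.isLeft_iff.1 this
  have hg : ∀ b : N₁, ∃ a : M₁, e (Sum.inl a) = Sum.inl b := fun b => by
    obtain ⟨x, hx⟩ := e.surjective (Sum.inl b)
    have := (h1 x).1 (by rw [hx]; rfl)
    obtain ⟨a, rfl⟩ := Sum.isLeft_iff.1 this
    exact ⟨a, hx⟩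
  choose f hf using hf
  choose g hg using hg
  refine ⟨⟨⟨f, g, ?_, ?_⟩, fun f => isEmptyElim f, ?_⟩⟩
  · intro a
    have := (hg (f a)).trans (hf a).symm
    exact Sum.inl_injective (e.injective this)
  · intro b
    exact Sum.inl_injective ((hf _).symm.trans (hg b))
  · intro n r x
    have := e.map_rel (rl (L₂ := L₂) r) (Sum.inl ∘ x)
    have h2 : e ∘ Sum.inl ∘ x = Sum.inl ∘ f ∘ x := funext fun i => hf _
    rw [h2, relMap_rl, relMap_rl] at this
    simpa [Sum.inl_injective.comp_left.eq_iff] using this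

theorem equiv_right {M₁ M₂ N₁ N₂ : Type w} [L₂.IsRelational] [L₁.Structure M₁] [L₂.Structure M₂]
    [L₁.Structure N₁] [L₂.Structure N₂] (e : (M₁ ⊕ M₂) ≃[duLang L₁ L₂] (N₁ ⊕ N₂)) :
    Nonempty (M₂ ≃[L₂] N₂) := by
  have h1 : ∀ x, (e x).isRight = true ↔ x.isRight = true := by
    intro x
    have := e.map_rel (pp L₁ L₂ false) (fun _ => x)
    rwa [relMap_pf, relMap_pf] at this
  have hf : ∀ a : M₂, ∃ b : N₂, e (Sum.inr a) = Sum.inr b := fun a => by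
    have := (h1 (Sum.inr a)).2 rfl
    exact Sum.isRight_iff.1 this
  have hg : ∀ b : N₂, ∃ a : M₂, e (Sum.inr a) = Sum.inr b := fun b => by
    obtain ⟨x, hx⟩ := e.surjective (Sum.inr b)
    have := (h1 x).1 (by rw [hx]; rfl)
    obtain ⟨a, rfl⟩ := Sum.isRight_iff.1 this
    exact ⟨a, hx⟩
  choose f hf using hf
  choose g hg using hg
  refine ⟨⟨⟨f, g, ?_, ?_⟩, fun f => isEmptyElim f, ?_⟩⟩
  · intro a
    have := (hg (f a)).trans (hf a).symm
    exact Sum.inr_injective (e.injective this)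
  · intro b
    exact Sum.inr_injective ((hf _).symm.trans (hg b))
  · intro n r x
    have := e.map_rel (rr (L₁ := L₁) r) (Sum.inr ∘ x)
    have h2 : e ∘ Sum.inr ∘ x = Sum.inr ∘ f ∘ x := funext fun i => hf _
    rw [h2, relMap_rr, relMap_rr] at this
    simpa [Sum.inr_injective.comp_left.eq_iff] using this

/-! ### Decomposition of models -/

/-- "If `r` holds of a tuple then all its members satisfy `P`". -/
def axRel {L : FirstOrder.Language.{u, v}} {n : ℕ} (r : L.Relations n) (P : L.Relations 1)
    (i : Fin n) : L.Sentence :=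
  BoundedFormula.alls (α := Empty) (n := n)
    (.imp (.rel r fun j => Term.var (Sum.inr j)) (.rel P fun _ => Term.var (Sum.inr i)))

theorem realize_axRel {L : FirstOrder.Language.{u, v}} {n : ℕ} (r : L.Relations n)
    (P : L.Relations 1) (i : Fin n) (K : Type*) [L.Structure K] :
    K ⊨ axRel r P i ↔
      ∀ v : Fin n → K, Structure.RelMap r v → Structure.RelMap P (fun _ => v i) := by
  rw [axRel, Sentence.Realize, BoundedFormula.realize_alls]
  rfl

/-- "`P` is the complement of `Q`". -/
def axPart {L : FirstOrder.Language.{u, v}} (P Q : L.Relations 1) : L.Sentence :=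
  BoundedFormula.alls (α := Empty) (n := 1)
    (BoundedFormula.iff (.rel P fun _ => Term.var (Sum.inr 0))
      (∼(.rel Q fun _ => Term.var (Sum.inr 0))))

theorem realize_axPart {L : FirstOrder.Language.{u, v}} (P Q : L.Relations 1)
    (K : Type*) [L.Structure K] :
    K ⊨ axPart P Q ↔
      ∀ x : K, Structure.RelMap P (fun _ => x) ↔ ¬ Structure.RelMap Q (fun _ => x) := by
  rw [axPart, Sentence.Realize, BoundedFormula.realize_alls]
  simp only [BoundedFormula.realize_iff, BoundedFormula.realize_not]
  constructor
  · intro h x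
    exact h fun _ => x
  · intro h x
    exact h (x 0)

theorem decomp [L₁.IsRelational] [L₂.IsRelational]
    {M₁ M₂ : Type w} [L₁.Structure M₁] [L₂.Structure M₂]
    (K : Type*) [(duLang L₁ L₂).Structure K]
    (hK : ∀ φ : (duLang L₁ L₂).Sentence, (M₁ ⊕ M₂) ⊨ φ → K ⊨ φ) :
    ∃ (S₁ S₂ : Set K) (_ : L₁.Structure S₁) (_ : L₂.Structure S₂),
      (∀ φ : L₁.Sentence, M₁ ⊨ φ → S₁ ⊨ φ) ∧ (∀ φ : L₂.Sentence, M₂ ⊨ φ → S₂ ⊨ φ) ∧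
      Nonempty ((S₁ ⊕ S₂) ≃[duLang L₁ L₂] K) := by
  classical
  let S₁ : Set K := {x | Structure.RelMap (pp L₁ L₂ true) (fun _ => x)}
  let S₂ : Set K := {x | Structure.RelMap (pp L₁ L₂ false) (fun _ => x)}
  have hpart : ∀ x, x ∈ S₁ ↔ ¬ x ∈ S₂ := by
    refine (realize_axPart (pp L₁ L₂ true) (pp L₁ L₂ false) K).1 (hK _ ?_)
    rw [realize_axPart]
    intro x
    rw [relMap_pt, relMap_pf]
    simp
  have hl : ∀ {n : ℕ} (r : L₁.Relations n) (v : Fin n → K),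
      Structure.RelMap (rl (L₂ := L₂) r) v → ∀ i, v i ∈ S₁ := by
    intro n r v h i
    refine (realize_axRel (rl (L₂ := L₂) r) (pp L₁ L₂ true) i K).1 (hK _ ?_) v h
    rw [realize_axRel]
    rintro v ⟨t, rfl, _⟩
    rw [relMap_pt]; rfl
  have hr : ∀ {n : ℕ} (r : L₂.Relations n) (v : Fin n → K),
      Structure.RelMap (rr (L₁ := L₁) r) v → ∀ i, v i ∈ S₂ := by
    intro n r v h i
    refine (realize_axRel (rr (L₁ := L₁) r) (pp L₁ L₂ false) i K).1 (hK _ ?_) v h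
    rw [realize_axRel]
    rintro v ⟨t, rfl, _⟩
    rw [relMap_pf]; rfl
  letI i₁ : L₁.Structure S₁ := subStr (L' := duLang L₁ L₂) (fun r => rl r) K S₁
  letI i₂ : L₂.Structure S₂ := subStr (L' := duLang L₁ L₂) (fun r => rr r) K S₂
  refine ⟨S₁, S₂, i₁, i₂, ?_, ?_, ⟨⟨⟨Sum.elim Subtype.val Subtype.val,
    fun x => if h : x ∈ S₁ then Sum.inl ⟨x, h⟩ else
      Sum.inr ⟨x, not_not.1 (fun h' => h ((hpart x).2 h'))⟩, ?_, ?_⟩, ?_, ?_⟩⟩⟩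
  · intro φ hφ
    rw [← realize_relz_sentence (L' := duLang L₁ L₂) (fun r => rl r) (pp L₁ L₂ true)
      (Subtype.val : S₁ → K) Subtype.val_injective ?_ ?_ φ]
    · apply hK
      rw [realize_relz_sentence (L' := duLang L₁ L₂) (fun r => rl r) (pp L₁ L₂ true)
        (Sum.inl : M₁ → M₁ ⊕ M₂) Sum.inl_injective ?_ ?_ φ]
      · exact hφ
      · intro x
        rw [relMap_pt, Sum.isLeft_iff]
        simp only [eq_comm]
      · intro n r v
        rw [relMap_rl]
        simp [Sum.inl_injective.comp_left.eq_iff]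
    · intro x
      exact ⟨fun h => ⟨⟨x, h⟩, rfl⟩, by rintro ⟨y, rfl⟩; exact y.2⟩
    · intro n r v
      exact Iff.rfl
  · intro φ hφ
    rw [← realize_relz_sentence (L' := duLang L₁ L₂) (fun r => rr r) (pp L₁ L₂ false)
      (Subtype.val : S₂ → K) Subtype.val_injective ?_ ?_ φ]
    · apply hK
      rw [realize_relz_sentence (L' := duLang L₁ L₂) (fun r => rr r) (pp L₁ L₂ false)
        (Sum.inr : M₂ → M₁ ⊕ M₂) Sum.inr_injective ?_ ?_ φ]
      · exact hφ
      · intro x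
        rw [relMap_pf, Sum.isRight_iff]
        simp only [eq_comm]
      · intro n r v
        rw [relMap_rr]
        simp [Sum.inr_injective.comp_left.eq_iff]
    · intro x
      exact ⟨fun h => ⟨⟨x, h⟩, rfl⟩, by rintro ⟨y, rfl⟩; exact y.2⟩
    · intro n r v
      exact Iff.rfl
  · rintro (x | x)
    · simp [x.2]
    · have : ¬ x.1 ∈ S₁ := fun h => (hpart _).1 h x.2
      simp [this]
  · intro x
    by_cases h : x ∈ S₁ <;> simp [h]
  · intro n f
    exact isEmptyElim f
  · intro n r x
    obtain ⟨r, rfl⟩ | ⟨r, rfl⟩ | ⟨rfl, b, rfl⟩ := rel_cases r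
    · rw [relMap_rl]
      constructor
      · intro h
        have h' := hl r _ h
        have : ∀ i, ∃ j, x i = Sum.inl j := by
          intro i
          have := h' i
          rcases hx : x i with a | a
          · exact ⟨a, rfl⟩
          · simp only [Function.comp_apply, hx] at this
            exact absurd a.2 ((hpart _).1 this)
        choose t ht using this
        obtain rfl : x = Sum.inl ∘ t := funext ht
        exact ⟨t, rfl, h⟩
      · rintro ⟨t, rfl, h⟩
        exact h
    · rw [relMap_rr]
      constructor
      · intro h
        have h' := hr r _ h
        have : ∀ i, ∃ j, x i = Sum.inr j := by
          intro i
          have := h' i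
          rcases hx : x i with a | a
          · simp only [Function.comp_apply, hx] at this
            exact absurd this ((hpart _).1 a.2)
          · exact ⟨a, rfl⟩
        choose t ht using this
        obtain rfl : x = Sum.inr ∘ t := funext ht
        exact ⟨t, rfl, h⟩
      · rintro ⟨t, rfl, h⟩
        exact h
    · obtain ⟨y, rfl⟩ : ∃ y, x = fun _ => y := ⟨x 0, funext fun i => by
        rw [Subsingleton.elim i 0]⟩
      cases b
      · rw [relMap_pf]
        rcases y with y | y
        · exact iff_of_false ((hpart y.1).1 y.2) (by simp)
        · exact iff_of_true y.2 rfl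
      · rw [relMap_pt]
        rcases y with y | y
        · exact iff_of_true y.2 rfl
        · exact iff_of_false (fun h => (hpart y.1).1 h y.2) (by simp)

theorem complete_iff {T : L.Theory} (hc : T.IsComplete) {M N : Type*} [L.Structure M]
    [L.Structure N] [Nonempty M] [Nonempty N] (hM : M ⊨ T) (hN : N ⊨ T) (φ : L.Sentence) :
    M ⊨ φ ↔ N ⊨ φ := by
  rw [hc.realize_sentence_iff φ M, hc.realize_sentence_iff φ N]

theorem nonempty_of {M N : Type*} [L.Structure M] [L.Structure N] [Nonempty M]
    (h : ∀ φ : L.Sentence, M ⊨ φ → N ⊨ φ) : Nonempty N := by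
  have := h (BoundedFormula.ex (α := Empty) (n := 0) ⊤) (by
    rw [Sentence.Realize, Formula.Realize, BoundedFormula.realize_ex]
    exact ⟨Classical.arbitrary M, by simp⟩)
  rw [Sentence.Realize, Formula.Realize, BoundedFormula.realize_ex] at this
  exact ⟨this.choose⟩

end aux

/-- For small complete theories `T₁`, `T₂` with infinite models in disjoint relational
languages, the number of countable models of `T₁ ⊔ T₂ = Th(M₁ ⊔ M₂)` is the product of the
numbers of countable models of `T₁` and of `T₂`. -/
theorem IOmega_disjoint_union {L₁ L₂ : FirstOrder.Language.{u, v}}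
    [Countable L₁.Symbols] [Countable L₂.Symbols]
    [L₁.IsRelational] [L₂.IsRelational]
    (T₁ : L₁.Theory) (T₂ : L₂.Theory)
    (hc₁ : T₁.IsComplete) (hc₂ : T₂.IsComplete)
    (hs₁ : IsSmall T₁) (hs₂ : IsSmall T₂)
    (M₁ M₂ : Type w) [L₁.Structure M₁] [L₂.Structure M₂]
    (hM₁ : M₁ ⊨ T₁) (hM₂ : M₂ ⊨ T₂)
    (hinf₁ : Infinite M₁) (hinf₂ : Infinite M₂) :
    IOmega ((duLang L₁ L₂).completeTheory (M₁ ⊕ M₂)) = IOmega T₁ * IOmega T₂ := by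
  have hne₁ : Nonempty M₁ := inferInstance
  have hne₂ : Nonempty M₂ := inferInstance
  have hmod : ∀ (A : CtbleModel T₁) (B : CtbleModel T₂),
      (A.1.Carrier ⊕ B.1.Carrier) ⊨ (duLang L₁ L₂).completeTheory (M₁ ⊕ M₂) := by
    intro A B
    refine ⟨fun φ hφ => ?_⟩
    exact (realize_du (complete_iff hc₁ hM₁ A.1.is_model) (complete_iff hc₂ hM₂ B.1.is_model) φ).1 hφ
  let F : CtbleModel T₁ → CtbleModel T₂ →
      CtbleModel ((duLang L₁ L₂).completeTheory (M₁ ⊕ M₂)) := fun A B =>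
    ⟨@Theory.ModelType.of _ _ (A.1.Carrier ⊕ B.1.Carrier) _ (hmod A B) inferInstance,
      haveI := A.2
      haveI := B.2
      inferInstanceAs (Countable (A.1.Carrier ⊕ B.1.Carrier))⟩
  let G : Quotient (isoSetoid T₁) × Quotient (isoSetoid T₂) →
      Quotient (isoSetoid ((duLang L₁ L₂).completeTheory (M₁ ⊕ M₂))) := fun p =>
    Quotient.map₂ F (by
      rintro A A' ⟨e⟩ B B' ⟨e'⟩
      exact ⟨sumEquiv e e'⟩) p.1 p.2
  have hG : Function.Bijective G := by
    constructor
    · rintro ⟨a, b⟩ ⟨a', b'⟩ h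
      induction a using Quotient.inductionOn
      induction b using Quotient.inductionOn
      induction a' using Quotient.inductionOn
      induction b' using Quotient.inductionOn
      obtain ⟨e⟩ := Quotient.exact h
      exact Prod.ext (Quotient.sound (equiv_left e)) (Quotient.sound (equiv_right e))
    · intro c
      induction c using Quotient.inductionOn with
      | h K =>
      have hcK := K.2
      obtain ⟨S₁, S₂, i₁, i₂, h₁, h₂, ⟨e⟩⟩ := decomp (M₁ := M₁) (M₂ := M₂) K.1.Carrier
        (fun φ hφ => K.1.is_model.realize_of_mem φ hφ)
      have n₁ := nonempty_of h₁
      have n₂ := nonempty_of h₂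
      have m₁ : S₁ ⊨ T₁ := ⟨fun φ hφ => h₁ φ (hM₁.realize_of_mem φ hφ)⟩
      have m₂ : S₂ ⊨ T₂ := ⟨fun φ hφ => h₂ φ (hM₂.realize_of_mem φ hφ)⟩
      refine ⟨(Quotient.mk _ ⟨Theory.ModelType.of T₁ S₁, ?_⟩,
        Quotient.mk _ ⟨Theory.ModelType.of T₂ S₂, ?_⟩), Quotient.sound ⟨e⟩⟩
      · exact inferInstanceAs (Countable S₁)
      · exact inferInstanceAs (Countable S₂)
  rw [IOmega, IOmega, IOmega, Cardinal.mul_def]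
  exact (Cardinal.mk_congr (Equiv.ofBijective G hG)).symm

end QOM
end
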